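/- Let q ≥ 1, S ≥ q be integers, h as specified, m ≥ 1 an integer, and let C = {ξ_1,…,ξ_M} ⊂ S^q admit an M–Z quadrature of order m with weights W = (w_ξ). Let r > 0 and f ∈ W_r with ‖f‖_{W_r} = 1. Then there is a constant c > 0 depending only on q, h, r, and the M–Z constant such that for every integer n with 1 ≤ n ≤ m, ‖f − σ_n(C,W;h;f)‖_∞ ≤ c n^{−r}. -/

import Mathlib

noncomputable section

open MeasureTheory Finset

namespace SD

/-- Euclidean space `ℝ^(q+1)`. -/
abbrev Euc (q : ℕ) := EuclideanSpace ℝ (Fin (q + 1))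

/-- The unit sphere `S^q ⊂ ℝ^(q+1)`, as a type. -/
abbrev Sph (q : ℕ) : Type := Metric.sphere (0 : Euc q) 1

/-- Dot product of two points of the sphere. -/
def dot {q : ℕ} (x y : Sph q) : ℝ := ∑ i, (x : Euc q) i * (y : Euc q) i

/-- Geodesic distance `arccos (x ⬝ y)` on the sphere. -/
def gdist {q : ℕ} (x y : Sph q) : ℝ := Real.arccos (dot x y)

/-- The mesh norm `δ_C(S^q)` of a finite set of points. -/
def meshNorm {q : ℕ} (C : Finset (Sph q)) : ℝ :=
  ⨆ x : Sph q, sInf ((fun ξ => gdist x ξ) '' (C : Set (Sph q)))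

/-- `f : S^q → ℝ` belongs to `Π_n^q` : it is the restriction to the sphere of an algebraic
polynomial in `q+1` variables of total degree at most `n`. -/
def InPi (q n : ℕ) (f : Sph q → ℝ) : Prop :=
  ∃ P : MvPolynomial (Fin (q + 1)) ℝ, P.totalDegree ≤ n ∧
    ∀ x : Sph q, f x = MvPolynomial.eval (fun i => (x : Euc q) i) P

/-- `f` is a spherical harmonic of degree `ℓ` : the restriction to the sphere of a
homogeneous harmonic polynomial of degree `ℓ`. -/
def IsSphHarm (q ℓ : ℕ) (f : Sph q → ℝ) : Prop :=
  ∃ P : MvPolynomial (Fin (q + 1)) ℝ, P.IsHomogeneous ℓ ∧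
    (∑ i : Fin (q + 1), MvPolynomial.pderiv i (MvPolynomial.pderiv i P)) = 0 ∧
    ∀ x : Sph q, f x = MvPolynomial.eval (fun i => (x : Euc q) i) P

/-- Rotation of a point of the sphere by a linear isometry of the ambient space. -/
def rotate {q : ℕ} (R : Euc q ≃ₗᵢ[ℝ] Euc q) (x : Sph q) : Sph q :=
  ⟨R x, by
    have hx : ‖(x : Euc q)‖ = 1 := mem_sphere_zero_iff_norm.mp x.2
    simp [mem_sphere_zero_iff_norm, hx]⟩

/-- `μ` is invariant under all rotations of the sphere. -/
def RotInvariant (q : ℕ) (μ : Measure (Sph q)) : Prop :=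
  ∀ R : Euc q ≃ₗᵢ[ℝ] Euc q, Measure.map (rotate R) μ = μ

/-- `IterIntBV S f` : `f` is an `S` times iterated integral of a function of bounded
variation (on `[0,∞)`). -/
def IterIntBV : ℕ → (ℝ → ℝ) → Prop
  | 0, f => BoundedVariationOn f (Set.Ici 0)
  | (S + 1), f => ∃ g : ℝ → ℝ, IterIntBV S g ∧ ∀ x : ℝ, 0 ≤ x → f x = f 0 + ∫ t in (0 : ℝ)..x, g t

/-- The standing hypotheses on the filter function `h` : `h = 1` on `[0,1/2]`, `h = 0` on
`(1,∞)`, `h` nonincreasing on `[0,∞)`, and `h` an `S` times iterated integral of a function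
of bounded variation. -/
def GoodH (S : ℕ) (h : ℝ → ℝ) : Prop :=
  (∀ x : ℝ, 0 ≤ x → x ≤ 1 / 2 → h x = 1) ∧
  (∀ x : ℝ, 1 < x → h x = 0) ∧
  (∀ x y : ℝ, 0 ≤ x → x ≤ y → h y ≤ h x) ∧
  IterIntBV S h

/-- `Y ℓ ·` is, for each `ℓ`, an orthonormal basis of the space of degree `ℓ` spherical
harmonics in `L²(μ)`. -/
def GoodBasis (q : ℕ) (μ : Measure (Sph q)) (d : ℕ → ℕ)
    (Y : (ℓ : ℕ) → Fin (d ℓ) → Sph q → ℝ) : Prop :=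
  (∀ ℓ k, IsSphHarm q ℓ (Y ℓ k)) ∧
  (∀ (ℓ ℓ' : ℕ) (k : Fin (d ℓ)) (k' : Fin (d ℓ')),
      ∫ x, Y ℓ k x * Y ℓ' k' x ∂μ = if ℓ = ℓ' ∧ (k : ℕ) = (k' : ℕ) then 1 else 0) ∧
  (∀ (ℓ : ℕ) (f : Sph q → ℝ), IsSphHarm q ℓ f →
      ∃ a : Fin (d ℓ) → ℝ, ∀ x, f x = ∑ k, a k * Y ℓ k x)

/-- The kernel `Φ_n(h; x·ξ) = Σ_{ℓ=0}^n h(ℓ/n) Σ_k Y_{ℓ,k}(x) Y_{ℓ,k}(ξ)`. -/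
def Phi {q : ℕ} (d : ℕ → ℕ) (Y : (ℓ : ℕ) → Fin (d ℓ) → Sph q → ℝ) (h : ℝ → ℝ) (n : ℕ)
    (x ξ : Sph q) : ℝ :=
  ∑ ℓ ∈ range (n + 1), h ((ℓ : ℝ) / (n : ℝ)) * ∑ k, Y ℓ k x * Y ℓ k ξ

/-- The discretized operator `σ_n(C, W; h; Z, x) = Σ_{ξ∈C} w_ξ z_ξ Φ_n(h; x·ξ)`. -/
def sigmaOp {q : ℕ} (d : ℕ → ℕ) (Y : (ℓ : ℕ) → Fin (d ℓ) → Sph q → ℝ) (h : ℝ → ℝ) (n : ℕ)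
    (C : Finset (Sph q)) (w : Sph q → ℝ) (z : Sph q → ℝ) (x : Sph q) : ℝ :=
  ∑ ξ ∈ C, w ξ * z ξ * Phi d Y h n x ξ

/-- The summability operator `σ*_n(h; f, x) = ∫ f(ζ) Φ_n(h; x·ζ) dμ(ζ)`. -/
def sigmaStar {q : ℕ} (μ : Measure (Sph q)) (d : ℕ → ℕ)
    (Y : (ℓ : ℕ) → Fin (d ℓ) → Sph q → ℝ) (h : ℝ → ℝ) (n : ℕ) (f : Sph q → ℝ)
    (x : Sph q) : ℝ :=
  ∫ ζ, f ζ * Phi d Y h n x ζ ∂μ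

/-- Sup norm on the sphere. -/
def supNorm {q : ℕ} (f : Sph q → ℝ) : ℝ := ⨆ x : Sph q, |f x|

/-- Sup norm on a subset of the sphere. -/
def supNormOn {q : ℕ} (K : Set (Sph q)) (f : Sph q → ℝ) : ℝ := ⨆ x ∈ K, |f x|

/-- The spherical cap of radius `δ` centered at `x₀`. -/
def cap {q : ℕ} (x₀ : Sph q) (δ : ℝ) : Set (Sph q) := {x | gdist x x₀ ≤ δ}

/-- `C` admits a Marcinkiewicz–Zygmund quadrature of order `m` with weights `w` and
M–Z constant `c₀`. -/
def MZQuad (q : ℕ) (μ : Measure (Sph q)) (m : ℕ) (C : Finset (Sph q)) (w : Sph q → ℝ)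
    (c₀ : ℝ) : Prop :=
  (∀ P : Sph q → ℝ, InPi q (2 * m) P → ∑ ξ ∈ C, w ξ * P ξ = ∫ x, P x ∂μ) ∧
  (∀ P : Sph q → ℝ, InPi q (2 * m) P → ∀ p : ℝ, 1 ≤ p →
      (∑ ξ ∈ C, |w ξ| * |P ξ| ^ p) ^ (1 / p) ≤ c₀ * (∫ x, |P x| ^ p ∂μ) ^ (1 / p))

/-- The sequence `n ↦ 2^((n+1)r) ‖σ*_{2^(n+1)}(h;f) − σ*_{2^n}(h;f)‖_{∞,K}`. -/
def WrSeqOn {q : ℕ} (K : Set (Sph q)) (μ : Measure (Sph q)) (d : ℕ → ℕ)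
    (Y : (ℓ : ℕ) → Fin (d ℓ) → Sph q → ℝ) (h : ℝ → ℝ) (r : ℝ) (f : Sph q → ℝ) (n : ℕ) : ℝ :=
  (2 : ℝ) ^ (((n : ℝ) + 1) * r) *
    supNormOn K (fun x => sigmaStar μ d Y h (2 ^ (n + 1)) f x - sigmaStar μ d Y h (2 ^ n) f x)

/-- The norm `‖f‖_{W_r(K)}`. -/
def WrNormOn {q : ℕ} (K : Set (Sph q)) (μ : Measure (Sph q)) (d : ℕ → ℕ)
    (Y : (ℓ : ℕ) → Fin (d ℓ) → Sph q → ℝ) (h : ℝ → ℝ) (r : ℝ) (f : Sph q → ℝ) : ℝ :=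
  supNorm f + ⨆ n : ℕ, WrSeqOn K μ d Y h r f n

/-- The norm `‖f‖_{W_r}`. -/
def WrNorm {q : ℕ} (μ : Measure (Sph q)) (d : ℕ → ℕ)
    (Y : (ℓ : ℕ) → Fin (d ℓ) → Sph q → ℝ) (h : ℝ → ℝ) (r : ℝ) (f : Sph q → ℝ) : ℝ :=
  WrNormOn Set.univ μ d Y h r f

/-- Membership in `W_r(K)` : `f` is continuous and the `W_r(K)` seminorm is finite. -/
def MemWrOn {q : ℕ} (K : Set (Sph q)) (μ : Measure (Sph q)) (d : ℕ → ℕ)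
    (Y : (ℓ : ℕ) → Fin (d ℓ) → Sph q → ℝ) (h : ℝ → ℝ) (r : ℝ) (f : Sph q → ℝ) : Prop :=
  Continuous f ∧ BddAbove (Set.range (WrSeqOn K μ d Y h r f))

/-- `y` is an orthonormal basis of `Π_n^q` in `L²(μ)` (so `N = dim Π_n^q`), whose `0`-th
element is the constant polynomial `1`. -/
def GoodPolyBasis (q n N : ℕ) (μ : Measure (Sph q)) (y : Fin N → Sph q → ℝ) : Prop :=
  (∀ i, InPi q n (y i)) ∧
  (∀ i j, ∫ x, y i x * y j x ∂μ = if i = j then 1 else 0) ∧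
  (∀ P : Sph q → ℝ, InPi q n P → ∃ a : Fin N → ℝ, ∀ x, P x = ∑ i, a i * y i x) ∧
  (∀ i : Fin N, (i : ℕ) = 0 → ∀ x, y i x = 1)

/-- The Gram matrix `(G_N)_{i,j} = Σ_{ξ∈C} v_ξ y_i(ξ) y_j(ξ)`. -/
def gram {q N : ℕ} (C : Finset (Sph q)) (v : Sph q → ℝ) (y : Fin N → Sph q → ℝ) :
    Matrix (Fin N) (Fin N) ℝ :=
  Matrix.of fun i j => ∑ ξ ∈ C, v ξ * y i ξ * y j ξ

/-- The least squares quadrature weights `w_ξ^{LSQ} = v_ξ Σ_k (G_N⁻¹)_{i₀,k} y_k(ξ)`. -/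
def wLSQ {q N : ℕ} (C : Finset (Sph q)) (v : Sph q → ℝ) (y : Fin N → Sph q → ℝ) (i0 : Fin N)
    (ξ : Sph q) : ℝ :=
  v ξ * ∑ k, (gram C v y)⁻¹ i0 k * y k ξ

/-- Two–sided Marcinkiewicz–Zygmund inequalities for the masses `v` on `C`, for all
`1 ≤ p ≤ ∞`. -/
def VMZ (q n : ℕ) (μ : Measure (Sph q)) (C : Finset (Sph q)) (v : Sph q → ℝ)
    (c₁ c₂ : ℝ) : Prop :=
  (∀ P : Sph q → ℝ, InPi q n P → ∀ p : ℝ, 1 ≤ p →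
      c₁ * (∫ x, |P x| ^ p ∂μ) ^ (1 / p) ≤ (∑ ξ ∈ C, v ξ * |P ξ| ^ p) ^ (1 / p) ∧
      (∑ ξ ∈ C, v ξ * |P ξ| ^ p) ^ (1 / p) ≤ c₂ * (∫ x, |P x| ^ p ∂μ) ^ (1 / p)) ∧
  (∀ P : Sph q → ℝ, InPi q n P →
      c₁ * supNorm P ≤ (⨆ ξ ∈ (C : Set (Sph q)), |P ξ|) ∧
      (⨆ ξ ∈ (C : Set (Sph q)), |P ξ|) ≤ c₂ * supNorm P)

/-- The power series of `(1 - X)^(-1/2)`. -/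
def invSqrtSeries : PowerSeries ℝ :=
  PowerSeries.mk fun k => ∏ i ∈ range k, (2 * (i : ℝ) + 1) / (2 * i + 2)

lemma invSqrtSeries_constantCoeff : PowerSeries.constantCoeff invSqrtSeries = 1 := by
  simp [invSqrtSeries, ← PowerSeries.coeff_zero_eq_constantCoeff_apply]

lemma invSqrtSeries_derivative :
    2 * (PowerSeries.derivative ℝ invSqrtSeries * (1 - PowerSeries.X)) = invSqrtSeries := by
  have h2 : (2 : PowerSeries ℝ) = PowerSeries.C (2 : ℝ) := (map_ofNat _ 2).symm
  ext n
  rw [h2, PowerSeries.coeff_C_mul, mul_sub, mul_one, map_sub]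
  cases n with
  | zero =>
    rw [PowerSeries.coeff_zero_mul_X, PowerSeries.coeff_derivative]
    simp [invSqrtSeries]
  | succ n =>
    rw [PowerSeries.coeff_succ_mul_X, PowerSeries.coeff_derivative, PowerSeries.coeff_derivative]
    simp only [invSqrtSeries, PowerSeries.coeff_mk, prod_range_succ]
    push_cast
    field_simp
    ring

lemma invSqrtSeries_sq : invSqrtSeries ^ 2 * (1 - PowerSeries.X) = 1 := by
  apply PowerSeries.derivative.ext
  · rw [Derivation.leibniz, Derivation.map_one_eq_zero, Derivation.leibniz_pow, map_sub,
      PowerSeries.derivative_X, Derivation.map_one_eq_zero]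
    simp only [smul_eq_mul, nsmul_eq_mul]
    have := invSqrtSeries_derivative
    push_cast
    linear_combination (invSqrtSeries) * this
  · simp [invSqrtSeries_constantCoeff]

lemma invSqrtSeries_subst_sq {R : Type*} [CommRing R] [Algebra ℝ R] {y : PowerSeries R}
    (hy : PowerSeries.constantCoeff y = 0) :
    (invSqrtSeries.subst y) ^ 2 * (1 - y) = 1 := by
  have hs : PowerSeries.HasSubst y := PowerSeries.HasSubst.of_constantCoeff_zero' hy
  have h := congrArg (PowerSeries.substAlgHom (R := ℝ) hs) invSqrtSeries_sq
  rw [map_mul, map_pow, map_sub, map_one, PowerSeries.substAlgHom_X,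
    PowerSeries.coe_substAlgHom] at h
  exact h

lemma coeff_pow_eq_zero_of_lt {R : Type*} [CommRing R] {y : PowerSeries R}
    (hy : PowerSeries.constantCoeff y = 0) {m k : ℕ} (hmk : m < k) :
    PowerSeries.coeff m (y ^ k) = 0 :=
  PowerSeries.X_pow_dvd_iff.mp (pow_dvd_pow_of_dvd (PowerSeries.X_dvd_iff.mpr hy) k) m hmk

lemma coeff_subst_eq_sum {R : Type*} [CommRing R] [Algebra ℝ R] {y : PowerSeries R}
    (hy : PowerSeries.constantCoeff y = 0) (A : PowerSeries ℝ) {n N : ℕ} (hn : n < N) :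
    PowerSeries.coeff n (A.subst y) =
      ∑ k ∈ range N, PowerSeries.coeff k A • PowerSeries.coeff n (y ^ k) := by
  have hs : PowerSeries.HasSubst y := PowerSeries.HasSubst.of_constantCoeff_zero' hy
  rw [PowerSeries.coeff_subst' hs]
  apply finsum_eq_sum_of_support_subset
  intro k hk
  simp only [coe_range, Set.mem_Iio]
  by_contra hc
  exact hk (by simp [coeff_pow_eq_zero_of_lt hy (by omega : n < k)])

lemma coeff_mul_subst {y : PowerSeries ℝ} (hy : PowerSeries.constantCoeff y = 0)
    (W A : PowerSeries ℝ) (n : ℕ) :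
    PowerSeries.coeff n (W * A.subst y) =
      ∑ k ∈ range (n + 1), PowerSeries.coeff k A * PowerSeries.coeff n (W * y ^ k) := by
  simp only [PowerSeries.coeff_mul, mul_sum]
  rw [sum_comm]
  refine sum_congr rfl fun p hp => ?_
  have : p.2 < n + 1 := by
    have := mem_antidiagonal.mp hp
    omega
  rw [coeff_subst_eq_sum hy A this, mul_sum]
  refine sum_congr rfl fun k _ => ?_
  rw [smul_eq_mul]
  ring

/-- Power series with nonnegative coefficients. -/
def NonnegCoeff (f : PowerSeries ℝ) : Prop := ∀ n, 0 ≤ PowerSeries.coeff n f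

lemma NonnegCoeff.mul {f g : PowerSeries ℝ} (hf : NonnegCoeff f) (hg : NonnegCoeff g) :
    NonnegCoeff (f * g) := fun n => by
  rw [PowerSeries.coeff_mul]
  exact sum_nonneg fun p _ => mul_nonneg (hf _) (hg _)

lemma NonnegCoeff.pow {f : PowerSeries ℝ} (hf : NonnegCoeff f) (k : ℕ) : NonnegCoeff (f ^ k) := by
  induction k with
  | zero =>
    intro n
    rw [pow_zero, PowerSeries.coeff_one]
    split_ifs <;> norm_num
  | succ k ih => rw [pow_succ]; exact ih.mul hf

/-- The power series `1 / (1 - X)`. -/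
def geomSeries : PowerSeries ℝ := PowerSeries.mk 1

lemma geomSeries_mul : geomSeries * (1 - PowerSeries.X) = 1 :=
  PowerSeries.mk_one_mul_one_sub_eq_one ℝ

lemma geomSeries_nonneg : NonnegCoeff geomSeries := fun n => by simp [geomSeries]

/-- The power series `1 - 2 t X + X ^ 2`. -/
def quadSeries (t : ℝ) : PowerSeries ℝ :=
  1 - PowerSeries.C (2 * t) * PowerSeries.X + PowerSeries.X ^ 2

lemma quadSeries_constantCoeff (t : ℝ) : PowerSeries.constantCoeff (quadSeries t) = 1 := by
  simp [quadSeries]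

/-- The values `U_n(c)` of the Chebyshev polynomials of the second kind. -/
def chebU (c : ℝ) : ℕ → ℝ
  | 0 => 1
  | 1 => 2 * c
  | (n + 2) => 2 * c * chebU c (n + 1) - chebU c n

lemma chebU_sq_generating (c : ℝ) :
    PowerSeries.mk (fun n => chebU c n ^ 2) *
      ((1 - PowerSeries.X) * quadSeries (2 * c ^ 2 - 1)) = 1 + PowerSeries.X := by
  obtain ⟨K, hK⟩ : ∃ K : ℝ, K = 4 * c ^ 2 - 1 := ⟨_, rfl⟩
  have e : PowerSeries.mk (fun n => chebU c n ^ 2) *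
      ((1 - PowerSeries.X) * quadSeries (2 * c ^ 2 - 1)) =
      PowerSeries.mk (fun n => chebU c n ^ 2)
        - PowerSeries.C K * (PowerSeries.mk (fun n => chebU c n ^ 2) * PowerSeries.X)
        + PowerSeries.C K * (PowerSeries.mk (fun n => chebU c n ^ 2) * PowerSeries.X ^ 2)
        - PowerSeries.mk (fun n => chebU c n ^ 2) * PowerSeries.X ^ 3 := by
    rw [hK]
    simp only [quadSeries, map_sub, map_mul, map_one, map_pow, map_ofNat]
    ring
  rw [e]
  ext n
  simp only [map_sub, map_add, PowerSeries.coeff_mul_X_pow', PowerSeries.coeff_C_mul,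
    PowerSeries.coeff_one, PowerSeries.coeff_X, PowerSeries.coeff_mk]
  rcases n with _ | _ | _ | n
  · simp [chebU, PowerSeries.coeff_zero_mul_X]
  · simp [chebU, hK]
    ring
  · simp [chebU, hK]
    ring
  · simp [chebU, hK]
    ring

lemma fejer_nonneg {t : ℝ} (ht : -1 ≤ t) {Q : PowerSeries ℝ}
    (hQ : Q * ((1 - PowerSeries.X) * quadSeries t) = 1 + PowerSeries.X) : NonnegCoeff Q := by
  have hc : 2 * (√((1 + t) / 2)) ^ 2 - 1 = t := by
    rw [Real.sq_sqrt (by linarith)]; ring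
  have h := chebU_sq_generating (√((1 + t) / 2))
  rw [hc] at h
  have hne : (1 - PowerSeries.X) * quadSeries t ≠ 0 := fun h0 => by
    have := congrArg PowerSeries.constantCoeff h0
    simp [quadSeries_constantCoeff] at this
  have : Q = PowerSeries.mk (fun n => chebU (√((1 + t) / 2)) n ^ 2) :=
    mul_right_cancel₀ hne (hQ.trans h.symm)
  intro n
  rw [this, PowerSeries.coeff_mk]
  positivity

lemma integral_sin_sq_pow (k : ℕ) :
    (1 / Real.pi) * ∫ ψ in (0 : ℝ)..Real.pi, (Real.sin ψ ^ 2) ^ k =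
      PowerSeries.coeff k invSqrtSeries := by
  simp only [← pow_mul]
  rw [integral_sin_pow_even]
  simp only [invSqrtSeries, PowerSeries.coeff_mk]
  field_simp

/-- The inverse of `1 + X`. -/
def altSeries : PowerSeries ℝ := (1 + PowerSeries.X)⁻¹

lemma altSeries_mul : altSeries * (1 + PowerSeries.X) = 1 :=
  PowerSeries.inv_mul_cancel _ (by simp)

lemma eq_of_sq_mul_eq {D L M : PowerSeries ℝ} (hL : L ^ 2 * D = 1) (hM : M ^ 2 * D = 1)
    (hL0 : PowerSeries.constantCoeff L = 1) (hM0 : PowerSeries.constantCoeff M = 1) : L = M := by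
  have hD : D ≠ 0 := by
    rintro rfl
    simp at hL
  have h1 : (L - M) * (L + M) = 0 := by
    apply mul_right_cancel₀ hD
    linear_combination hL - hM
  rcases mul_eq_zero.mp h1 with h | h
  · exact sub_eq_zero.mp h
  · have := congrArg PowerSeries.constantCoeff h
    rw [map_add, hL0, hM0] at this
    norm_num at this

lemma constantCoeff_subst_invSqrtSeries {R : Type*} [CommRing R] [Algebra ℝ R] {y : PowerSeries R}
    (hy : PowerSeries.constantCoeff y = 0) :
    PowerSeries.constantCoeff (invSqrtSeries.subst y : PowerSeries R) = 1 := by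
  rw [← PowerSeries.coeff_zero_eq_constantCoeff_apply, coeff_subst_eq_sum hy _ zero_lt_one]
  simp [invSqrtSeries_constantCoeff]

/-- The partial sums of Legendre polynomials are nonnegative on `[-1, 1]`. -/
lemma legendre_sum_nonneg {t : ℝ} (ht : -1 ≤ t) {L : PowerSeries ℝ}
    (hL : L ^ 2 * quadSeries t = 1) (hL0 : PowerSeries.constantCoeff L = 1) :
    NonnegCoeff (L * geomSeries) := by
  set y : PowerSeries ℝ := PowerSeries.C (2 * (1 + t)) * PowerSeries.X * altSeries ^ 2 with hy
  have hy0 : PowerSeries.constantCoeff y = 0 := by simp [hy]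
  have ha := altSeries_mul
  have hg := geomSeries_mul
  have hquad : ∀ u : ℝ, altSeries ^ 2 * quadSeries ((1 + t) * u - 1) = 1 - PowerSeries.C u * y := by
    intro u
    have : quadSeries ((1 + t) * u - 1) =
        (1 + PowerSeries.X) ^ 2 - PowerSeries.C u * PowerSeries.C (2 * (1 + t)) * PowerSeries.X := by
      simp only [quadSeries, map_sub, map_mul, map_one, map_add, map_ofNat]
      ring
    rw [this, hy]
    linear_combination (altSeries * (1 + PowerSeries.X) + 1) * ha
  have hM : L = altSeries * invSqrtSeries.subst y := by
    refine eq_of_sq_mul_eq hL ?_ hL0 ?_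
    · have h1 := hquad 1
      rw [mul_one, add_sub_cancel_left, map_one, one_mul] at h1
      have h2 := invSqrtSeries_subst_sq hy0
      rw [← h2, ← h1]
      ring
    · rw [map_mul, constantCoeff_subst_invSqrtSeries hy0, mul_one]
      simp [altSeries]
  have hF : ∀ u : ℝ, 0 ≤ u →
      NonnegCoeff (altSeries * geomSeries * (PowerSeries.mk fun k => u ^ k).subst y) := by
    intro u hu
    refine fejer_nonneg (t := (1 + t) * u - 1) (by nlinarith) ?_
    have hs : PowerSeries.HasSubst y := PowerSeries.HasSubst.of_constantCoeff_zero' hy0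
    have h1 : (PowerSeries.mk fun k => u ^ k) * (1 - PowerSeries.C u * PowerSeries.X) = 1 := by
      ext n
      rw [mul_sub, mul_one, mul_left_comm, map_sub, PowerSeries.coeff_C_mul]
      cases n with
      | zero => simp [PowerSeries.coeff_zero_mul_X]
      | succ n =>
        rw [PowerSeries.coeff_succ_mul_X]
        simp [PowerSeries.coeff_one, pow_succ, mul_comm]
    have h2 := congrArg (PowerSeries.substAlgHom (R := ℝ) hs) h1
    have h3 : PowerSeries.substAlgHom (R := ℝ) hs (PowerSeries.C u) = PowerSeries.C u :=
      (PowerSeries.substAlgHom (R := ℝ) hs).commutes u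
    rw [map_mul, map_sub, map_mul, map_one, PowerSeries.substAlgHom_X, h3,
      PowerSeries.coe_substAlgHom] at h2
    rw [← hquad u] at h2
    linear_combination (1 + PowerSeries.X) * h2 +
      (1 + PowerSeries.X) * (PowerSeries.mk fun k => u ^ k).subst y * altSeries ^ 2 *
        quadSeries ((1 + t) * u - 1) * hg -
      geomSeries * (PowerSeries.mk fun k => u ^ k).subst y * altSeries *
        quadSeries ((1 + t) * u - 1) * (1 - PowerSeries.X) * ha
  intro n
  have key : PowerSeries.coeff n (L * geomSeries) = (1 / Real.pi) *
      ∫ ψ in (0 : ℝ)..Real.pi, PowerSeries.coeff n (altSeries * geomSeries *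
        (PowerSeries.mk fun k => (Real.sin ψ ^ 2) ^ k).subst y) := by
    have : L * geomSeries = altSeries * geomSeries * invSqrtSeries.subst y := by
      rw [hM]; ring
    rw [this]
    simp only [coeff_mul_subst hy0, PowerSeries.coeff_mk]
    rw [intervalIntegral.integral_finsetSum]
    · rw [mul_sum]
      refine sum_congr rfl fun k _ => ?_
      rw [intervalIntegral.integral_mul_const, ← integral_sin_sq_pow]
      ring
    · intro k _
      apply Continuous.intervalIntegrable
      fun_prop
  rw [key]
  refine mul_nonneg (by positivity) ?_
  exact intervalIntegral.integral_nonneg Real.pi_pos.le fun ψ _ => hF _ (sq_nonneg _) n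

/-- Kogbetliantz: the Cesàro means of order at least `q` of the zonal expansion are nonnegative. -/
lemma cesaro_nonneg {q S : ℕ} (hq : 1 ≤ q) (hS : q ≤ S) {t : ℝ} (ht : -1 ≤ t)
    {L : PowerSeries ℝ} (hL : L ^ 2 * quadSeries t = 1)
    (hL0 : PowerSeries.constantCoeff L = 1) :
    NonnegCoeff ((1 - PowerSeries.X ^ 2) * L ^ (q + 1) * geomSeries ^ (S + 1)) := by
  obtain ⟨p, rfl⟩ : ∃ p, q = p + 1 := ⟨q - 1, by omega⟩
  obtain ⟨s, rfl⟩ : ∃ s, S = p + 1 + s := ⟨S - (p + 1), by omega⟩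
  have hg := geomSeries_mul
  have h1 : NonnegCoeff ((1 + PowerSeries.X) * L ^ 2 * geomSeries) := by
    apply fejer_nonneg ht
    linear_combination (1 + PowerSeries.X) * hL +
      (1 + PowerSeries.X) * L ^ 2 * quadSeries t * hg
  have h2 := (h1.mul ((legendre_sum_nonneg ht hL hL0).pow p)).mul (geomSeries_nonneg.pow s)
  convert h2 using 1
  linear_combination (1 + PowerSeries.X) * L ^ (p + 2) * geomSeries ^ (p + 1 + s) * hg

/-- A derivation acting on the coefficients of a power series. -/
def coeffDer {R : Type*} [CommRing R] [Algebra ℝ R] (δ : Derivation ℝ R R) :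
    Derivation ℝ (PowerSeries R) (PowerSeries R) :=
  Derivation.mk'
    { toFun := fun f => PowerSeries.mk fun n => δ (PowerSeries.coeff n f)
      map_add' := fun f g => by ext n; simp
      map_smul' := fun a f => by ext n; simp }
    (fun f g => by
      ext n
      simp only [LinearMap.coe_mk, AddHom.coe_mk, PowerSeries.coeff_mk, smul_eq_mul, map_add,
        PowerSeries.coeff_mul, map_sum, Derivation.leibniz, sum_add_distrib]
      congr 1
      rw [← Finset.Nat.sum_antidiagonal_swap]
      rfl)

section coeffDer

variable {R : Type*} [CommRing R] [Algebra ℝ R] (δ : Derivation ℝ R R)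

lemma coeff_coeffDer (f : PowerSeries R) (n : ℕ) :
    PowerSeries.coeff n (coeffDer δ f) = δ (PowerSeries.coeff n f) := by
  simp [coeffDer]

lemma coeffDer_C (a : R) : coeffDer δ (PowerSeries.C a) = PowerSeries.C (δ a) := by
  ext n
  rw [coeff_coeffDer, PowerSeries.coeff_C, PowerSeries.coeff_C]
  split_ifs <;> simp

lemma coeffDer_X : coeffDer δ PowerSeries.X = 0 := by
  ext n
  rw [coeff_coeffDer, PowerSeries.coeff_X]
  split_ifs <;> simp

end coeffDer

/-- Power series with coefficients in `ℝ[x_0, …, x_q]`. -/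
abbrev PolySeries (q : ℕ) := PowerSeries (MvPolynomial (Fin (q + 1)) ℝ)

/-- The linear form `x ↦ x ⬝ ξ` as a polynomial. -/
def dotPoly {q : ℕ} (ξ : Sph q) : MvPolynomial (Fin (q + 1)) ℝ :=
  ∑ i, MvPolynomial.C ((ξ : Euc q) i) * MvPolynomial.X i

/-- The polynomial `|x|²`. -/
def normSqPoly (q : ℕ) : MvPolynomial (Fin (q + 1)) ℝ := ∑ i, MvPolynomial.X i ^ 2

/-- The series `2 (x ⬝ ξ) X - |x|² X²`. -/
def kernelArg {q : ℕ} (ξ : Sph q) : PolySeries q :=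
  2 * PowerSeries.C (dotPoly ξ) * PowerSeries.X - PowerSeries.C (normSqPoly q) * PowerSeries.X ^ 2

lemma kernelArg_constantCoeff {q : ℕ} (ξ : Sph q) :
    PowerSeries.constantCoeff (kernelArg ξ) = 0 := by
  simp [kernelArg]

/-- The generating series `(1 - 2 (x ⬝ ξ) X + |x|² X²)^(-1/2)`. -/
def legendreSeries {q : ℕ} (ξ : Sph q) : PolySeries q :=
  invSqrtSeries.subst (kernelArg ξ)

/-- The Poisson kernel as a power series with polynomial coefficients. -/
def poissonSeries {q : ℕ} (ξ : Sph q) : PolySeries q :=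
  (1 - PowerSeries.C (normSqPoly q) * PowerSeries.X ^ 2) * legendreSeries ξ ^ (q + 1)

lemma legendreSeries_sq {q : ℕ} (ξ : Sph q) : legendreSeries ξ ^ 2 * (1 - kernelArg ξ) = 1 :=
  invSqrtSeries_subst_sq (kernelArg_constantCoeff ξ)

lemma pderiv_dotPoly {q : ℕ} (ξ : Sph q) (i : Fin (q + 1)) :
    MvPolynomial.pderiv i (dotPoly ξ) = MvPolynomial.C ((ξ : Euc q) i) := by
  simp [dotPoly, MvPolynomial.pderiv_X, Pi.single_apply]

lemma pderiv_normSqPoly {q : ℕ} (i : Fin (q + 1)) :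
    MvPolynomial.pderiv i (normSqPoly q) = 2 * MvPolynomial.X i := by
  simp [normSqPoly, MvPolynomial.pderiv_X, Derivation.leibniz_pow, Pi.single_apply]

/-- Half the negative `i`-th derivative of `1 - kernelArg ξ`. -/
def kernelDer {q : ℕ} (ξ : Sph q) (i : Fin (q + 1)) :
    PolySeries q :=
  PowerSeries.C (MvPolynomial.C ((ξ : Euc q) i)) * PowerSeries.X -
    PowerSeries.C (MvPolynomial.X i) * PowerSeries.X ^ 2

lemma coeffDer_ofNat {R : Type*} [CommRing R] [Algebra ℝ R] (δ : Derivation ℝ R R) :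
    coeffDer δ (2 : PowerSeries R) = 0 := by
  have := (coeffDer δ).map_natCast 2
  simpa using this

lemma coeffDer_kernelArg {q : ℕ} (ξ : Sph q) (i : Fin (q + 1)) :
    coeffDer (MvPolynomial.pderiv i) (kernelArg ξ) = 2 * kernelDer ξ i := by
  simp only [kernelArg, kernelDer, map_sub, Derivation.leibniz, coeffDer_C, coeffDer_X,
    Derivation.leibniz_pow, pderiv_dotPoly, pderiv_normSqPoly, smul_eq_mul, map_mul, map_ofNat,
    coeffDer_ofNat]
  ring

lemma coeffDer_kernelDer {q : ℕ} (ξ : Sph q) (i : Fin (q + 1)) :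
    coeffDer (MvPolynomial.pderiv i) (kernelDer ξ i) = - PowerSeries.X ^ 2 := by
  simp only [kernelDer, map_sub, Derivation.leibniz, coeffDer_C, coeffDer_X,
    Derivation.leibniz_pow, smul_eq_mul, MvPolynomial.pderiv_C,
    MvPolynomial.pderiv_X_self, map_zero, map_one]
  ring

lemma coeffDer_legendreSeries {q : ℕ} (ξ : Sph q) (i : Fin (q + 1)) :
    coeffDer (MvPolynomial.pderiv i) (legendreSeries ξ) =
      legendreSeries ξ ^ 3 * kernelDer ξ i := by
  have h := congrArg (coeffDer (MvPolynomial.pderiv i)) (legendreSeries_sq ξ)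
  have h1 := legendreSeries_sq ξ
  simp only [map_sub, Derivation.leibniz, Derivation.leibniz_pow, Derivation.map_one_eq_zero,
    coeffDer_kernelArg, smul_eq_mul, nsmul_eq_mul] at h
  push_cast at h
  have h2 : (2 : PolySeries q) ≠ 0 := fun h0 => by
    have := congrArg (fun f => MvPolynomial.constantCoeff (PowerSeries.constantCoeff f)) h0
    simp only [map_ofNat, map_zero] at this
    norm_num at this
  apply mul_left_cancel₀ h2
  linear_combination legendreSeries ξ * h -
    2 * coeffDer (MvPolynomial.pderiv i) (legendreSeries ξ) * h1

lemma coeffDer_legendreSeries_pow {q : ℕ} (ξ : Sph q) (i : Fin (q + 1)) (k : ℕ) :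
    coeffDer (MvPolynomial.pderiv i) (legendreSeries ξ ^ (k + 1)) =
      (k + 1) * legendreSeries ξ ^ (k + 3) * kernelDer ξ i := by
  rw [Derivation.leibniz_pow, coeffDer_legendreSeries]
  simp only [smul_eq_mul, nsmul_eq_mul, Nat.add_sub_cancel]
  push_cast
  ring

lemma coeffDer_normFactor {q : ℕ} (i : Fin (q + 1)) :
    coeffDer (MvPolynomial.pderiv i)
      (1 - PowerSeries.C (normSqPoly q) * PowerSeries.X ^ 2) =
      - 2 * PowerSeries.C (MvPolynomial.X i) * PowerSeries.X ^ 2 := by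
  simp only [map_sub, Derivation.leibniz, coeffDer_C, coeffDer_X, Derivation.map_one_eq_zero,
    Derivation.leibniz_pow, pderiv_normSqPoly, smul_eq_mul, map_mul, map_ofNat]
  ring

lemma coeffDer_poissonSeries {q : ℕ} (ξ : Sph q) (i : Fin (q + 1)) :
    coeffDer (MvPolynomial.pderiv i) (poissonSeries ξ) =
      (- 2 * PowerSeries.X ^ 2 * legendreSeries ξ ^ (q + 1)) * PowerSeries.C (MvPolynomial.X i) +
      ((1 - PowerSeries.C (normSqPoly q) * PowerSeries.X ^ 2) *
        (((q : PolySeries q) + 1) * legendreSeries ξ ^ (q + 3))) * kernelDer ξ i := by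
  rw [poissonSeries, Derivation.leibniz, coeffDer_normFactor, coeffDer_legendreSeries_pow]
  simp only [smul_eq_mul]
  ring

lemma coeffDer_coeffDer_poissonSeries {q : ℕ} (ξ : Sph q) (i : Fin (q + 1)) :
    coeffDer (MvPolynomial.pderiv i) (coeffDer (MvPolynomial.pderiv i) (poissonSeries ξ)) =
      (- 2 * PowerSeries.X ^ 2 * legendreSeries ξ ^ (q + 1) -
        (1 - PowerSeries.C (normSqPoly q) * PowerSeries.X ^ 2) *
          ((q : PolySeries q) + 1) * legendreSeries ξ ^ (q + 3) * PowerSeries.X ^ 2) +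
      (- 4 * ((q : PolySeries q) + 1) * PowerSeries.X ^ 2 * legendreSeries ξ ^ (q + 3)) *
        (PowerSeries.C (MvPolynomial.X i) * kernelDer ξ i) +
      ((1 - PowerSeries.C (normSqPoly q) * PowerSeries.X ^ 2) * ((q : PolySeries q) + 1) * ((q : PolySeries q) + 3) *
        legendreSeries ξ ^ (q + 5)) * kernelDer ξ i ^ 2 := by
  have hc : coeffDer (MvPolynomial.pderiv i)
      ((q : PolySeries q) + 1) = 0 := by
    have := (coeffDer (MvPolynomial.pderiv (R := ℝ) i)).map_natCast (q + 1)
    push_cast at this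
    exact this
  have hX : coeffDer (MvPolynomial.pderiv (R := ℝ) i) (PowerSeries.X ^ 2) = 0 := by
    rw [Derivation.leibniz_pow, coeffDer_X]
    simp
  have hL := coeffDer_legendreSeries_pow ξ i (q + 2)
  push_cast at hL
  rw [coeffDer_poissonSeries]
  simp only [map_add, Derivation.leibniz, coeffDer_normFactor, coeffDer_legendreSeries_pow,
    coeffDer_kernelDer, coeffDer_C, MvPolynomial.pderiv_X_self, smul_eq_mul, map_one, hc, hX, hL,
    map_neg, coeffDer_ofNat]
  ring

lemma sum_sq_sphere {q : ℕ} (ξ : Sph q) : ∑ i, (ξ : Euc q) i ^ 2 = 1 := by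
  have h := EuclideanSpace.real_norm_sq_eq (ξ : Euc q)
  rw [mem_sphere_zero_iff_norm.mp ξ.2] at h
  simpa using h.symm

lemma sum_X_mul_kernelDer {q : ℕ} (ξ : Sph q) :
    ∑ i, PowerSeries.C (MvPolynomial.X i) * kernelDer ξ i =
      PowerSeries.C (dotPoly ξ) * PowerSeries.X -
        PowerSeries.C (normSqPoly q) * PowerSeries.X ^ 2 := by
  simp only [dotPoly, normSqPoly, map_sum, map_mul, map_pow, sum_mul, ← sum_sub_distrib]
  refine sum_congr rfl fun i _ => ?_
  simp only [kernelDer]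
  ring

lemma sum_kernelDer_sq {q : ℕ} (ξ : Sph q) :
    ∑ i, kernelDer ξ i ^ 2 = PowerSeries.X ^ 2 * (1 - kernelArg ξ) := by
  have h1 : (1 : PolySeries q) =
      ∑ i, PowerSeries.C (MvPolynomial.C ((ξ : Euc q) i)) ^ 2 := by
    simp only [← map_pow, ← map_sum]
    rw [sum_sq_sphere, map_one, map_one]
  rw [kernelArg]
  nth_rw 1 [h1]
  simp only [dotPoly, normSqPoly, map_sum, map_mul, map_pow, sum_mul, mul_sum, ← sum_sub_distrib]
  refine sum_congr rfl fun i _ => ?_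
  simp only [kernelDer]
  ring

lemma sum_coeffDer_poissonSeries {q : ℕ} (ξ : Sph q) :
    ∑ i, coeffDer (MvPolynomial.pderiv i) (coeffDer (MvPolynomial.pderiv i) (poissonSeries ξ)) =
      0 := by
  simp only [coeffDer_coeffDer_poissonSeries, sum_add_distrib, ← mul_sum, sum_X_mul_kernelDer,
    sum_kernelDer_sq, sum_const, card_univ, Fintype.card_fin, nsmul_eq_mul]
  have h1 := legendreSeries_sq ξ
  have h2 : kernelArg ξ = 2 * PowerSeries.C (dotPoly ξ) * PowerSeries.X -
    PowerSeries.C (normSqPoly q) * PowerSeries.X ^ 2 := rfl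
  push_cast
  generalize legendreSeries ξ = L at *
  generalize kernelArg ξ = D at *
  subst h2
  linear_combination ((1 - PowerSeries.C (normSqPoly q) * PowerSeries.X ^ 2) * (↑q + 1) * (↑q + 3) *
    L ^ (q + 3) * PowerSeries.X ^ 2 + 2 * (↑q + 1) * PowerSeries.X ^ 2 * L ^ (q + 1)) * h1

/-- The `n`-th coefficient is a homogeneous polynomial of degree `n`. -/
def HomSeries {q : ℕ} (f : PolySeries q) : Prop :=
  ∀ n, (PowerSeries.coeff n f).IsHomogeneous n

lemma HomSeries.mul {q : ℕ} {f g : PolySeries q} (hf : HomSeries f) (hg : HomSeries g) :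
    HomSeries (f * g) := fun n => by
  rw [PowerSeries.coeff_mul]
  refine MvPolynomial.IsHomogeneous.sum _ _ _ fun p hp => ?_
  rw [← mem_antidiagonal.mp hp]
  exact (hf _).mul (hg _)

lemma HomSeries.one {q : ℕ} : HomSeries (1 : PolySeries q) := fun n => by
  rw [PowerSeries.coeff_one]
  split_ifs with h
  · rw [h]; exact MvPolynomial.isHomogeneous_one _ _
  · exact MvPolynomial.isHomogeneous_zero _ _ _

lemma HomSeries.pow {q : ℕ} {f : PolySeries q} (hf : HomSeries f) (k : ℕ) :
    HomSeries (f ^ k) := by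
  induction k with
  | zero => rw [pow_zero]; exact HomSeries.one
  | succ k ih => rw [pow_succ]; exact ih.mul hf

lemma HomSeries.sub {q : ℕ} {f g : PolySeries q} (hf : HomSeries f) (hg : HomSeries g) :
    HomSeries (f - g) := fun n => by
  rw [map_sub]
  exact (hf n).sub (hg n)

lemma HomSeries.C_mul_X_pow {q : ℕ} {a : MvPolynomial (Fin (q + 1)) ℝ} {k : ℕ}
    (ha : a.IsHomogeneous k) : HomSeries (PowerSeries.C a * PowerSeries.X ^ k) := fun n => by
  rw [PowerSeries.coeff_C_mul, PowerSeries.coeff_X_pow]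
  split_ifs with h
  · rw [h, mul_one]; exact ha
  · rw [mul_zero]; exact MvPolynomial.isHomogeneous_zero _ _ _

lemma dotPoly_isHomogeneous {q : ℕ} (ξ : Sph q) : (dotPoly ξ).IsHomogeneous 1 := by
  refine MvPolynomial.IsHomogeneous.sum _ _ _ fun i _ => ?_
  simpa using (MvPolynomial.isHomogeneous_C _ _).mul (MvPolynomial.isHomogeneous_X ℝ i)

lemma normSqPoly_isHomogeneous (q : ℕ) : (normSqPoly q).IsHomogeneous 2 := by
  refine MvPolynomial.IsHomogeneous.sum _ _ _ fun i _ => ?_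
  simpa using (MvPolynomial.isHomogeneous_X ℝ i).pow 2

lemma kernelArg_homSeries {q : ℕ} (ξ : Sph q) : HomSeries (kernelArg ξ) := by
  have h1 : (MvPolynomial.C 2 * dotPoly ξ).IsHomogeneous 1 := by
    simpa using (MvPolynomial.isHomogeneous_C _ _).mul (dotPoly_isHomogeneous ξ)
  have := (HomSeries.C_mul_X_pow h1).sub (HomSeries.C_mul_X_pow (normSqPoly_isHomogeneous q))
  simpa only [kernelArg, map_mul, map_ofNat, pow_one] using this

lemma legendreSeries_homSeries {q : ℕ} (ξ : Sph q) : HomSeries (legendreSeries ξ) := fun n => by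
  rw [legendreSeries, coeff_subst_eq_sum (kernelArg_constantCoeff ξ) _ (Nat.lt_succ_self n)]
  refine MvPolynomial.IsHomogeneous.sum _ _ _ fun k _ => ?_
  rw [MvPolynomial.smul_eq_C_mul]
  simpa using (MvPolynomial.isHomogeneous_C _ _).mul ((kernelArg_homSeries ξ).pow k n)

lemma poissonSeries_homSeries {q : ℕ} (ξ : Sph q) : HomSeries (poissonSeries ξ) :=
  (HomSeries.one.sub (HomSeries.C_mul_X_pow (normSqPoly_isHomogeneous q))).mul
    ((legendreSeries_homSeries ξ).pow _)

/-- The zonal kernel of degree `ℓ`. -/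
def zonal {q : ℕ} (ℓ : ℕ) (x ξ : Sph q) : ℝ :=
  MvPolynomial.eval (fun i => (x : Euc q) i) (PowerSeries.coeff ℓ (poissonSeries ξ))

lemma zonal_isSphHarm {q : ℕ} (ℓ : ℕ) (ξ : Sph q) : IsSphHarm q ℓ (fun x => zonal ℓ x ξ) := by
  refine ⟨PowerSeries.coeff ℓ (poissonSeries ξ), poissonSeries_homSeries ξ ℓ, ?_, fun _ => rfl⟩
  have h := congrArg (PowerSeries.coeff ℓ) (sum_coeffDer_poissonSeries ξ)
  simpa only [map_sum, coeff_coeffDer, map_zero] using h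

/-- The generating series of the Legendre polynomials evaluated at `x ⬝ ξ`. -/
def legendreAt {q : ℕ} (x ξ : Sph q) : PowerSeries ℝ :=
  PowerSeries.map (MvPolynomial.eval fun i => (x : Euc q) i) (legendreSeries ξ)

lemma map_kernelArg {q : ℕ} (x ξ : Sph q) :
    PowerSeries.map (MvPolynomial.eval fun i => (x : Euc q) i) (1 - kernelArg ξ) =
      quadSeries (dot x ξ) := by
  have h1 : MvPolynomial.eval (fun i => (x : Euc q) i) (dotPoly ξ) = dot x ξ := by
    simp [dotPoly, dot, mul_comm]
  have h2 : MvPolynomial.eval (fun i => (x : Euc q) i) (normSqPoly q) = 1 := by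
    simp [normSqPoly, sum_sq_sphere]
  simp only [kernelArg, quadSeries, map_sub, map_mul, map_one, map_pow, PowerSeries.map_C,
    PowerSeries.map_X, h1, h2, map_ofNat]
  ring

lemma legendreAt_sq {q : ℕ} (x ξ : Sph q) : legendreAt x ξ ^ 2 * quadSeries (dot x ξ) = 1 := by
  rw [← map_kernelArg, legendreAt, ← map_pow, ← map_mul, legendreSeries_sq, map_one]

lemma legendreAt_constantCoeff {q : ℕ} (x ξ : Sph q) :
    PowerSeries.constantCoeff (legendreAt x ξ) = 1 := by
  rw [← PowerSeries.coeff_zero_eq_constantCoeff_apply, legendreAt, PowerSeries.coeff_map,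
    PowerSeries.coeff_zero_eq_constantCoeff_apply, legendreSeries,
    constantCoeff_subst_invSqrtSeries (kernelArg_constantCoeff ξ), map_one]

lemma map_poissonSeries {q : ℕ} (x ξ : Sph q) :
    PowerSeries.mk (fun ℓ => zonal ℓ x ξ) =
      (1 - PowerSeries.X ^ 2) * legendreAt x ξ ^ (q + 1) := by
  have h2 : MvPolynomial.eval (fun i => (x : Euc q) i) (normSqPoly q) = 1 := by
    simp [normSqPoly, sum_sq_sphere]
  have h3 : PowerSeries.mk (fun ℓ => zonal ℓ x ξ) =
      PowerSeries.map (MvPolynomial.eval fun i => (x : Euc q) i) (poissonSeries ξ) := by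
    ext n
    simp [zonal]
  rw [h3, poissonSeries, legendreAt]
  simp only [map_sub, map_mul, map_one, map_pow, PowerSeries.map_C, PowerSeries.map_X, h2, one_mul]

lemma dot_eq_inner {q : ℕ} (x ξ : Sph q) : dot x ξ = inner ℝ (ξ : Euc q) (x : Euc q) := by
  simp [dot, PiLp.inner_apply]

lemma norm_sph {q : ℕ} (x : Sph q) : ‖(x : Euc q)‖ = 1 := mem_sphere_zero_iff_norm.mp x.2

lemma neg_one_le_dot {q : ℕ} (x ξ : Sph q) : -1 ≤ dot x ξ := by
  rw [dot_eq_inner]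
  have := abs_real_inner_le_norm (ξ : Euc q) (x : Euc q)
  rw [norm_sph, norm_sph] at this
  exact (abs_le.mp (by simpa using this)).1

/-- The Cesàro number `(n + S choose S)`. -/
def cesaroNum (S n : ℕ) : ℝ := ((S + n).choose S : ℝ)

/-- The unnormalised Cesàro kernel of order `S`. -/
def cesaroKer {q : ℕ} (S n : ℕ) (x ξ : Sph q) : ℝ :=
  ∑ ℓ ∈ range (n + 1), zonal ℓ x ξ * cesaroNum S (n - ℓ)

lemma geomSeries_pow (S : ℕ) : geomSeries ^ (S + 1) = PowerSeries.mk (cesaroNum S) :=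
  PowerSeries.mk_one_pow_eq_mk_choose_add ℝ S

lemma cesaroKer_eq_coeff {q : ℕ} (S n : ℕ) (x ξ : Sph q) :
    cesaroKer S n x ξ =
      PowerSeries.coeff n (PowerSeries.mk (fun ℓ => zonal ℓ x ξ) * geomSeries ^ (S + 1)) := by
  rw [geomSeries_pow, PowerSeries.coeff_mul, Finset.Nat.sum_antidiagonal_eq_sum_range_succ_mk]
  simp [cesaroKer]

lemma cesaroKer_nonneg {q S : ℕ} (hq : 1 ≤ q) (hS : q ≤ S) (n : ℕ) (x ξ : Sph q) :
    0 ≤ cesaroKer S n x ξ := by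
  rw [cesaroKer_eq_coeff, map_poissonSeries]
  exact cesaro_nonneg hq hS (neg_one_le_dot x ξ) (legendreAt_sq x ξ)
    (legendreAt_constantCoeff x ξ) n

lemma zonal_zero {q : ℕ} (x ξ : Sph q) : zonal 0 x ξ = 1 := by
  have h := congrArg (PowerSeries.coeff 0) (map_poissonSeries x ξ)
  rw [PowerSeries.coeff_mk] at h
  rw [h]
  simp [legendreAt_constantCoeff]

lemma zonal_one {q : ℕ} (x ξ : Sph q) : zonal 1 x ξ = (q + 1) * dot x ξ := by
  have hL : PowerSeries.coeff 1 (legendreAt x ξ) = dot x ξ := by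
    have h := congrArg (PowerSeries.coeff 1) (legendreAt_sq x ξ)
    simp [PowerSeries.coeff_one_mul, PowerSeries.coeff_one_pow, legendreAt_constantCoeff,
      quadSeries, PowerSeries.coeff_one, PowerSeries.coeff_X_pow] at h
    linarith
  have h := congrArg (PowerSeries.coeff 1) (map_poissonSeries x ξ)
  rw [PowerSeries.coeff_mk] at h
  rw [h]
  simp [PowerSeries.coeff_one_mul, PowerSeries.coeff_one_pow, legendreAt_constantCoeff, hL,
    PowerSeries.coeff_one, PowerSeries.coeff_X_pow]

lemma InPi.continuous {q n : ℕ} {f : Sph q → ℝ} (hf : InPi q n f) : Continuous f := by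
  obtain ⟨P, -, hP⟩ := hf
  rw [funext hP]
  refine (MvPolynomial.continuous_eval P).comp (continuous_pi fun i => ?_)
  fun_prop

lemma IsSphHarm.inPi {q ℓ : ℕ} {f : Sph q → ℝ} (hf : IsSphHarm q ℓ f) : InPi q ℓ f := by
  obtain ⟨P, hP, -, h⟩ := hf
  exact ⟨P, hP.totalDegree_le, h⟩

lemma IsSphHarm.continuous {q ℓ : ℕ} {f : Sph q → ℝ} (hf : IsSphHarm q ℓ f) : Continuous f :=
  hf.inPi.continuous

lemma integrable_of_continuous {q : ℕ} (μ : Measure (Sph q)) [IsFiniteMeasure μ]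
    {f : Sph q → ℝ} (hf : Continuous f) : Integrable f μ :=
  hf.integrable_of_hasCompactSupport (HasCompactSupport.of_compactSpace f)

lemma zonal_continuous {q : ℕ} (ℓ : ℕ) (ξ : Sph q) : Continuous fun x => zonal ℓ x ξ :=
  (zonal_isSphHarm ℓ ξ).continuous

lemma cesaroKer_continuous {q : ℕ} (S n : ℕ) (ξ : Sph q) :
    Continuous fun x => cesaroKer S n x ξ :=
  continuous_finsetSum _ fun ℓ _ => (zonal_continuous ℓ ξ).mul continuous_const

lemma dot_continuous {q : ℕ} (ξ : Sph q) : Continuous fun x => dot x ξ := by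
  unfold dot
  fun_prop

lemma GoodBasis.continuous {q : ℕ} {μ : Measure (Sph q)} {d : ℕ → ℕ}
    {Y : (ℓ : ℕ) → Fin (d ℓ) → Sph q → ℝ} (hY : GoodBasis q μ d Y) (ℓ : ℕ) (k : Fin (d ℓ)) :
    Continuous (Y ℓ k) := (hY.1 ℓ k).continuous

section Orthogonality

variable {q : ℕ} {μ : Measure (Sph q)} [IsProbabilityMeasure μ] {d : ℕ → ℕ}
  {Y : (ℓ : ℕ) → Fin (d ℓ) → Sph q → ℝ}

lemma GoodBasis.integral_sum_mul (hY : GoodBasis q μ d Y) (ℓ : ℕ) (a : Fin (d ℓ) → ℝ)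
    {g : Sph q → ℝ} (hg : Continuous g) :
    ∫ x, (∑ k, a k * Y ℓ k x) * g x ∂μ = ∑ k, a k * ∫ x, Y ℓ k x * g x ∂μ := by
  simp_rw [Finset.sum_mul, mul_assoc]
  rw [integral_finsetSum _ fun k _ =>
    (integrable_of_continuous μ ((hY.continuous ℓ k).fun_mul hg)).const_mul _]
  simp_rw [integral_const_mul]

lemma GoodBasis.integral_mul_eq_zero (hY : GoodBasis q μ d Y) {ℓ ℓ' : ℕ} {f g : Sph q → ℝ}
    (hf : IsSphHarm q ℓ f) (hg : IsSphHarm q ℓ' g) (h : ℓ ≠ ℓ') : ∫ x, f x * g x ∂μ = 0 := by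
  obtain ⟨a, ha⟩ := hY.2.2 ℓ f hf
  obtain ⟨b, hb⟩ := hY.2.2 ℓ' g hg
  simp_rw [ha]
  rw [hY.integral_sum_mul ℓ a hg.continuous]
  refine Finset.sum_eq_zero fun k _ => ?_
  simp_rw [mul_comm (Y ℓ k _), hb]
  rw [hY.integral_sum_mul ℓ' b (hY.continuous ℓ k)]
  simp [hY.2.1, h.symm]

lemma GoodBasis.integral_sum_mul_self (hY : GoodBasis q μ d Y) (ℓ : ℕ) (a : Fin (d ℓ) → ℝ)
    (k : Fin (d ℓ)) : ∫ x, (∑ j, a j * Y ℓ j x) * Y ℓ k x ∂μ = a k := by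
  rw [hY.integral_sum_mul ℓ a (hY.continuous ℓ k)]
  simp [hY.2.1, Fin.val_inj]

end Orthogonality

lemma dot_rotate {q : ℕ} (R : Euc q ≃ₗᵢ[ℝ] Euc q) (x ξ : Sph q) :
    dot (rotate R x) (rotate R ξ) = dot x ξ := by
  simp [dot_eq_inner, rotate]

lemma rotate_continuous {q : ℕ} (R : Euc q ≃ₗᵢ[ℝ] Euc q) : Continuous (rotate R) :=
  Continuous.subtype_mk (R.continuous.comp continuous_subtype_val) _

lemma exists_rotate_eq {q : ℕ} (ξ η : Sph q) : ∃ R : Euc q ≃ₗᵢ[ℝ] Euc q, rotate R ξ = η := by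
  refine ⟨(Submodule.span ℝ {(ξ : Euc q) - η})ᗮ.reflection, Subtype.ext ?_⟩
  exact Submodule.reflection_sub (by rw [norm_sph, norm_sph])

lemma integral_dot_sq_eq {q : ℕ} {μ : Measure (Sph q)} (hrot : RotInvariant q μ) (ξ η : Sph q) :
    ∫ x, dot x ξ ^ 2 ∂μ = ∫ x, dot x η ^ 2 ∂μ := by
  obtain ⟨R, rfl⟩ := exists_rotate_eq ξ η
  conv_rhs => rw [← hrot R]
  rw [integral_map (rotate_continuous R).measurable.aemeasurable
    ((dot_continuous _).fun_pow 2).aestronglyMeasurable]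
  simp_rw [dot_rotate]

lemma integral_dot_sq {q : ℕ} {μ : Measure (Sph q)} [IsProbabilityMeasure μ]
    (hrot : RotInvariant q μ) (ξ : Sph q) : ∫ x, dot x ξ ^ 2 ∂μ = 1 / (q + 1) := by
  let e : Fin (q + 1) → Sph q := fun i => ⟨EuclideanSpace.single i 1, by simp⟩
  have he : ∀ i (x : Sph q), dot x (e i) = (x : Euc q) i := fun i x => by
    simp [dot, e]
  have h1 : ∑ i, ∫ x, dot x (e i) ^ 2 ∂μ = 1 := by
    rw [← integral_finsetSum _ fun i _ => integrable_of_continuous μ ((dot_continuous _).fun_pow 2)]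
    simp [he, sum_sq_sphere]
  rw [Finset.sum_congr rfl fun i _ => integral_dot_sq_eq hrot (e i) ξ] at h1
  simp at h1
  field_simp
  linarith

lemma one_sub_dot {q : ℕ} (x ξ : Sph q) : 1 - dot x ξ = dist x ξ ^ 2 / 2 := by
  rw [Subtype.dist_eq, dist_eq_norm, norm_sub_sq_real, norm_sph, norm_sph, dot_eq_inner,
    real_inner_comm]
  ring

lemma cesaroNum_pos (S n : ℕ) : 0 < cesaroNum S n := by
  unfold cesaroNum
  exact_mod_cast Nat.choose_pos (Nat.le_add_right S n)

lemma cesaroNum_mul (S n : ℕ) : cesaroNum S n * (S + n + 1) = cesaroNum S (n + 1) * (n + 1) := by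
  have h := Nat.choose_mul_succ_eq (S + n) S
  rw [show S + n + 1 - S = n + 1 by omega] at h
  unfold cesaroNum
  exact_mod_cast h

lemma cesaroNum_sub (S n : ℕ) :
    cesaroNum S (n + 1) - cesaroNum S n = S / (S + n + 1) * cesaroNum S (n + 1) := by
  have h := cesaroNum_mul S n
  have : (S + n + 1 : ℝ) ≠ 0 := by positivity
  field_simp
  linarith

lemma tendsto_cesaroNum_div (S ℓ : ℕ) :
    Filter.Tendsto (fun n => cesaroNum S n / cesaroNum S (n + ℓ)) Filter.atTop (nhds 1) := by
  have h0 : ∀ n, cesaroNum S n ≠ 0 := fun n => (cesaroNum_pos S n).ne'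
  have h1 : Filter.Tendsto (fun n : ℕ => cesaroNum S n / cesaroNum S (n + 1)) Filter.atTop
      (nhds 1) := by
    have h2 : ∀ n : ℕ, cesaroNum S n / cesaroNum S (n + 1) = 1 - S / ((n : ℝ) + (S + 1)) := by
      intro n
      have h := cesaroNum_sub S n
      have := h0 (n + 1)
      rw [div_eq_iff this, sub_mul, add_comm (n : ℝ), add_right_comm, ← h]
      ring
    simp_rw [h2]
    have h3 : Filter.Tendsto (fun n : ℕ => (S : ℝ) / ((n : ℝ) + (S + 1))) Filter.atTop (nhds 0) :=
      tendsto_const_nhds.div_atTop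
        (Filter.tendsto_atTop_add_const_right _ _ tendsto_natCast_atTop_atTop)
    simpa using tendsto_const_nhds.sub h3
  induction ℓ with
  | zero => simp [div_self (h0 _)]
  | succ ℓ ih =>
    have h2 := ih.mul (h1.comp (Filter.tendsto_add_atTop_nat ℓ))
    rw [one_mul] at h2
    refine h2.congr fun n => ?_
    simp only [Function.comp]
    rw [div_mul_div_cancel₀ (h0 _), add_assoc]

/-- The Cesàro sum of order `S`, not normalised, of a function on the sphere. -/
def cesaroSum {q : ℕ} (μ : Measure (Sph q)) (S n : ℕ) (f : Sph q → ℝ) (ξ : Sph q) : ℝ :=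
  ∫ x, cesaroKer S n x ξ * f x ∂μ

lemma exists_abs_sub_le {q : ℕ} {f : Sph q → ℝ} (hf : Continuous f) {ε : ℝ} (hε : 0 < ε) :
    ∃ C, 0 ≤ C ∧ ∀ x ξ, |f x - f ξ| ≤ ε + C * (1 - dot x ξ) := by
  obtain ⟨δ, hδ, h⟩ := Metric.uniformContinuous_iff.mp
    (CompactSpace.uniformContinuous_of_continuous hf) ε hε
  obtain ⟨M, hM⟩ := isCompact_univ.exists_bound_of_continuousOn hf.continuousOn
  refine ⟨4 * |M| / δ ^ 2, by positivity, fun x ξ => ?_⟩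
  rw [one_sub_dot]
  rcases lt_or_ge (dist x ξ) δ with hd | hd
  · have := h hd
    rw [Real.dist_eq] at this
    have h2 : 0 ≤ 4 * |M| / δ ^ 2 * (dist x ξ ^ 2 / 2) := by positivity
    linarith
  · have h1 := hM x trivial
    have h2 := hM ξ trivial
    rw [Real.norm_eq_abs] at h1 h2
    have h3 : |f x - f ξ| ≤ 2 * |M| := by
      have := abs_sub (f x) (f ξ)
      have := le_abs_self M
      linarith
    have h4 : 2 * |M| ≤ 4 * |M| / δ ^ 2 * (dist x ξ ^ 2 / 2) := by
      rw [div_mul_eq_mul_div, le_div_iff₀ (by positivity)]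
      have := pow_le_pow_left₀ hδ.le hd 2
      nlinarith [abs_nonneg M]
    linarith

section Korovkin

variable {q : ℕ} {μ : Measure (Sph q)} [IsProbabilityMeasure μ] {d : ℕ → ℕ}
  {Y : (ℓ : ℕ) → Fin (d ℓ) → Sph q → ℝ}

lemma cesaroSum_eq_sum (S n : ℕ) {f : Sph q → ℝ} (hf : Continuous f) (ξ : Sph q) :
    cesaroSum μ S n f ξ =
      ∑ ℓ ∈ range (n + 1), cesaroNum S (n - ℓ) * ∫ x, zonal ℓ x ξ * f x ∂μ := by
  unfold cesaroSum cesaroKer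
  have h : ∀ x, (∑ ℓ ∈ range (n + 1), zonal ℓ x ξ * cesaroNum S (n - ℓ)) * f x =
      ∑ ℓ ∈ range (n + 1), cesaroNum S (n - ℓ) * (zonal ℓ x ξ * f x) := fun x => by
    rw [Finset.sum_mul]
    exact Finset.sum_congr rfl fun ℓ _ => by ring
  simp_rw [h]
  rw [integral_finsetSum _ fun ℓ _ =>
    (integrable_of_continuous μ ((zonal_continuous ℓ ξ).fun_mul hf)).const_mul _]
  simp_rw [integral_const_mul]

lemma cesaroSum_harm (hY : GoodBasis q μ d Y) (S n ℓ : ℕ) (hℓ : ℓ ≤ n) {f : Sph q → ℝ}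
    (hf : IsSphHarm q ℓ f) (ξ : Sph q) :
    cesaroSum μ S n f ξ = cesaroNum S (n - ℓ) * ∫ x, zonal ℓ x ξ * f x ∂μ := by
  rw [cesaroSum_eq_sum S n hf.continuous]
  refine Finset.sum_eq_single_of_mem ℓ (mem_range.mpr (by omega)) fun j _ hj => ?_
  rw [hY.integral_mul_eq_zero (zonal_isSphHarm j ξ) hf hj, mul_zero]

lemma integral_cesaroKer (hY : GoodBasis q μ d Y) (S n : ℕ) (ξ : Sph q) :
    ∫ x, cesaroKer S n x ξ ∂μ = cesaroNum S n := by
  have h := cesaroSum_harm hY S n 0 (Nat.zero_le n) (zonal_isSphHarm 0 ξ) ξ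
  simpa [cesaroSum, zonal_zero] using h

lemma integral_cesaroKer_mul_dot (hY : GoodBasis q μ d Y) (hrot : RotInvariant q μ) (S n : ℕ)
    (ξ : Sph q) : ∫ x, cesaroKer S (n + 1) x ξ * dot x ξ ∂μ = cesaroNum S n := by
  have h := cesaroSum_harm hY S (n + 1) 1 (by omega) (zonal_isSphHarm 1 ξ) ξ
  have h1 : ∀ x, ((q : ℝ) + 1) * dot x ξ * ((q + 1) * dot x ξ) = (q + 1) ^ 2 * dot x ξ ^ 2 :=
    fun x => by ring
  have h2 : ∀ x, cesaroKer S (n + 1) x ξ * (((q : ℝ) + 1) * dot x ξ) =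
      (q + 1) * (cesaroKer S (n + 1) x ξ * dot x ξ) := fun x => by ring
  simp only [cesaroSum, zonal_one, h1, h2, integral_const_mul, integral_dot_sq hrot,
    Nat.add_sub_cancel] at h
  have h3 : (q + 1 : ℝ) ≠ 0 := by positivity
  apply mul_left_cancel₀ h3
  rw [h]
  field_simp

/-- Korovkin-type convergence of the Cesàro means. -/
lemma cesaroSum_approx (hq : 1 ≤ q) {S : ℕ} (hS : q ≤ S) (hY : GoodBasis q μ d Y)
    (hrot : RotInvariant q μ) {f : Sph q → ℝ} (hf : Continuous f) {ε : ℝ} (hε : 0 < ε) :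
    ∃ N, ∀ n, N ≤ n → ∀ ξ, |cesaroSum μ S n f ξ / cesaroNum S n - f ξ| ≤ ε := by
  obtain ⟨C, hC, h⟩ := exists_abs_sub_le hf (half_pos hε)
  have hlim : Filter.Tendsto (fun n : ℕ => C * ((S : ℝ) / ((n : ℝ) + (S + 1)))) Filter.atTop
      (nhds (C * 0)) :=
    tendsto_const_nhds.mul (tendsto_const_nhds.div_atTop
        (Filter.tendsto_atTop_add_const_right _ _ tendsto_natCast_atTop_atTop))
  rw [mul_zero] at hlim
  obtain ⟨N, hN⟩ := Filter.eventually_atTop.mp (hlim.eventually_le_const (half_pos hε))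
  refine ⟨N + 1, fun n hn ξ => ?_⟩
  obtain ⟨n, rfl⟩ : ∃ k, n = k + 1 := ⟨n - 1, by omega⟩
  have hA := cesaroNum_pos S (n + 1)
  have hK := cesaroKer_continuous S (n + 1) ξ
  have h1 : cesaroSum μ S (n + 1) f ξ - cesaroNum S (n + 1) * f ξ =
      ∫ x, cesaroKer S (n + 1) x ξ * (f x - f ξ) ∂μ := by
    simp_rw [mul_sub]
    rw [integral_sub (integrable_of_continuous μ (hK.fun_mul hf))
      (integrable_of_continuous μ (hK.fun_mul continuous_const)), integral_mul_const,
      integral_cesaroKer hY]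
    rfl
  have h2 : |∫ x, cesaroKer S (n + 1) x ξ * (f x - f ξ) ∂μ| ≤
      ∫ x, ((ε / 2 + C) * cesaroKer S (n + 1) x ξ - C * (cesaroKer S (n + 1) x ξ * dot x ξ)) ∂μ := by
    refine (abs_integral_le_integral_abs).trans (integral_mono
      (integrable_of_continuous μ (hK.fun_mul (hf.sub continuous_const)).abs)
      (integrable_of_continuous μ ((continuous_const.fun_mul hK).sub
        (continuous_const.fun_mul (hK.fun_mul (dot_continuous ξ))))) fun x => ?_)
    have h3 := cesaroKer_nonneg hq hS (n + 1) x ξ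
    simp only [abs_mul, abs_of_nonneg h3]
    nlinarith [mul_le_mul_of_nonneg_left (h x ξ) h3]
  rw [integral_sub (integrable_of_continuous μ (continuous_const.fun_mul hK))
    (integrable_of_continuous μ (continuous_const.fun_mul (hK.fun_mul (dot_continuous ξ)))),
    integral_const_mul, integral_const_mul, integral_cesaroKer hY,
    integral_cesaroKer_mul_dot hY hrot] at h2
  have h4 := cesaroNum_sub S n
  have h5 := hN n (by omega)
  rw [show (n : ℝ) + (S + 1) = S + n + 1 by ring] at h5
  have h6 : cesaroSum μ S (n + 1) f ξ / cesaroNum S (n + 1) - f ξ =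
      (cesaroSum μ S (n + 1) f ξ - cesaroNum S (n + 1) * f ξ) / cesaroNum S (n + 1) := by
    field_simp
  rw [h6, abs_div, abs_of_pos hA, div_le_iff₀ hA, h1]
  refine h2.trans ?_
  have h7 : (ε / 2 + C) * cesaroNum S (n + 1) - C * cesaroNum S n =
      ε / 2 * cesaroNum S (n + 1) + C * (S / (S + n + 1)) * cesaroNum S (n + 1) := by
    rw [mul_assoc C, ← h4]
    ring
  rw [h7]
  nlinarith [mul_le_mul_of_nonneg_right h5 hA.le]

/-- The addition formula. -/
lemma sum_basis_mul_basis (hq : 1 ≤ q) (hY : GoodBasis q μ d Y) (hrot : RotInvariant q μ) (ℓ : ℕ)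
    (x ξ : Sph q) : ∑ k, Y ℓ k x * Y ℓ k ξ = zonal ℓ x ξ := by
  obtain ⟨a, ha⟩ := hY.2.2 ℓ _ (zonal_isSphHarm ℓ ξ)
  rw [ha]
  refine Finset.sum_congr rfl fun k _ => ?_
  rw [mul_comm]
  congr 1
  have h1 : ∀ n, cesaroSum μ q (n + ℓ) (Y ℓ k) ξ = cesaroNum q n * a k := fun n => by
    rw [cesaroSum_harm hY q (n + ℓ) ℓ (by omega) (hY.1 ℓ k)]
    simp_rw [ha]
    rw [hY.integral_sum_mul_self, Nat.add_sub_cancel]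
  have h2 := (tendsto_cesaroNum_div q ℓ).mul_const (a k)
  rw [one_mul] at h2
  refine tendsto_nhds_unique (Metric.tendsto_atTop.mpr fun ε hε => ?_) h2
  obtain ⟨N, hN⟩ := cesaroSum_approx hq le_rfl hY hrot (hY.continuous ℓ k) (half_pos hε)
  refine ⟨N, fun n hn => ?_⟩
  have := hN (n + ℓ) (by omega) ξ
  rw [h1, mul_div_right_comm] at this
  rw [Real.dist_eq]
  linarith

/-- `f` is a linear combination of the basis functions of degree at most `N`. -/
def InHarm (d : ℕ → ℕ) (Y : (ℓ : ℕ) → Fin (d ℓ) → Sph q → ℝ) (N : ℕ) (f : Sph q → ℝ) : Prop :=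
  ∃ b : (ℓ : ℕ) → Fin (d ℓ) → ℝ, ∀ x, f x = ∑ ℓ ∈ range (N + 1), ∑ k, b ℓ k * Y ℓ k x

lemma exists_inHarm_approx (hq : 1 ≤ q) (hY : GoodBasis q μ d Y) (hrot : RotInvariant q μ)
    {f : Sph q → ℝ} (hf : Continuous f) {ε : ℝ} (hε : 0 < ε) :
    ∃ N Q, InHarm d Y N Q ∧ ∀ x, |Q x - f x| ≤ ε := by
  obtain ⟨N, hN⟩ := cesaroSum_approx hq le_rfl hY hrot hf hε
  refine ⟨N, _, ⟨fun ℓ k => cesaroNum q (N - ℓ) / cesaroNum q N * ∫ x, Y ℓ k x * f x ∂μ,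
    fun ξ => ?_⟩, hN N le_rfl⟩
  rw [cesaroSum_eq_sum q N hf, Finset.sum_div]
  refine Finset.sum_congr rfl fun ℓ _ => ?_
  simp_rw [← sum_basis_mul_basis hq hY hrot, mul_comm (Y ℓ _ _) (Y ℓ _ ξ)]
  rw [hY.integral_sum_mul ℓ _ hf, Finset.mul_sum, Finset.sum_div]
  exact Finset.sum_congr rfl fun k _ => by ring

end Korovkin

/-- Interval integrability on the compact subintervals of `[0,∞)`. -/
def HalfLineIntegrable (g : ℝ → ℝ) : Prop :=
  ∀ a b, 0 ≤ a → 0 ≤ b → IntervalIntegrable g volume a b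

lemma HalfLineIntegrable.comp_add {g : ℝ → ℝ} (hg : HalfLineIntegrable g) {c : ℝ} (hc : 0 ≤ c) :
    HalfLineIntegrable fun x => g (x + c) := fun a b ha hb => by
  simpa using (hg (a + c) (b + c) (by linarith) (by linarith)).comp_add_right c

lemma HalfLineIntegrable.fwdDiff {g : ℝ → ℝ} (hg : HalfLineIntegrable g) {δ : ℝ} (hδ : 0 ≤ δ) :
    HalfLineIntegrable (fwdDiff δ g) := fun a b ha hb =>
  (hg.comp_add hδ a b ha hb).sub (hg a b ha hb)

lemma HalfLineIntegrable.fwdDiff_iterate {g : ℝ → ℝ} (hg : HalfLineIntegrable g) {δ : ℝ}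
    (hδ : 0 ≤ δ) (n : ℕ) : HalfLineIntegrable ((_root_.fwdDiff δ)^[n] g) := by
  induction n with
  | zero => exact hg
  | succ n ih => rw [Function.iterate_succ_apply']; exact ih.fwdDiff hδ

lemma uIcc_subset_Ici {a b : ℝ} (ha : 0 ≤ a) (hb : 0 ≤ b) : Set.uIcc a b ⊆ Set.Ici 0 :=
  fun _ hx => (le_min ha hb).trans hx.1

lemma IterIntBV.halfLineIntegrable {S : ℕ} {f : ℝ → ℝ} (hf : IterIntBV S f) :
    HalfLineIntegrable f := by
  induction S generalizing f with
  | zero =>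
    intro a b ha hb
    have hf' : BoundedVariationOn f (Set.Ici 0) := hf
    obtain ⟨p, q, hp, hq, rfl⟩ := hf'.locallyBoundedVariationOn.exists_monotoneOn_sub_monotoneOn
    have hs := uIcc_subset_Ici ha hb
    exact (hp.mono hs).intervalIntegrable.sub (hq.mono hs).intervalIntegrable
  | succ S ih =>
    obtain ⟨g, hg, hfg⟩ := hf
    intro a b ha hb
    have hm : 0 ≤ max a b := le_max_of_le_left ha
    have hc := intervalIntegral.continuousOn_primitive_interval'
      (ih hg 0 (max a b) le_rfl hm) Set.left_mem_uIcc
    rw [Set.uIcc_of_le hm] at hc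
    have hs : Set.uIcc a b ⊆ Set.Icc 0 (max a b) := fun x hx => ⟨(le_min ha hb).trans hx.1, hx.2⟩
    refine ContinuousOn.intervalIntegrable (((continuousOn_const (c := f 0)).add
      (hc.mono hs)).congr fun x hx => ?_)
    exact hfg x (hs hx).1

lemma fwdDiff_iterate_integral {δ : ℝ} (hδ : 0 ≤ δ) (n : ℕ) {g G : ℝ → ℝ}
    (hg : HalfLineIntegrable g) (hG : ∀ y, 0 ≤ y → G y = ∫ u in (0 : ℝ)..δ, g (y + u)) {y : ℝ}
    (hy : 0 ≤ y) :
    (fwdDiff δ)^[n] G y = ∫ u in (0 : ℝ)..δ, (fwdDiff δ)^[n] g (y + u) := by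
  induction n generalizing g G with
  | zero => exact hG y hy
  | succ n ih =>
    rw [Function.iterate_succ_apply, Function.iterate_succ_apply]
    refine ih (hg.fwdDiff hδ) fun y hy => ?_
    have hi : ∀ z, 0 ≤ z → IntervalIntegrable (fun u => g (z + u)) volume 0 δ := fun z hz => by
      simpa only [add_comm z] using hg.comp_add hz 0 δ le_rfl hδ
    rw [fwdDiff, hG y hy, hG _ (add_nonneg hy hδ),
      ← intervalIntegral.integral_sub (hi _ (add_nonneg hy hδ)) (hi y hy)]
    refine intervalIntegral.integral_congr fun u _ => ?_
    simp only [fwdDiff, add_right_comm]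

/-- The differences of order `S + 1` of an `S` times iterated integral of a function of bounded
variation are summable, with the natural scaling in the step. -/
lemma IterIntBV.sum_abs_fwdDiff_le {S : ℕ} {f : ℝ → ℝ} (hf : IterIntBV S f) :
    ∃ V, 0 ≤ V ∧ ∀ δ, 0 ≤ δ → ∀ N : ℕ, ∀ x, 0 ≤ x →
      ∑ k ∈ range N, |(fwdDiff δ)^[S + 1] f (x + k * δ)| ≤ V * δ ^ S := by
  induction S generalizing f with
  | zero =>
    refine ⟨(eVariationOn f (Set.Ici 0)).toReal, ENNReal.toReal_nonneg, fun δ hδ N x hx => ?_⟩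
    have hm : Monotone fun k : ℕ => x + k * δ := fun i j hij => by
      have : (i : ℝ) ≤ j := by exact_mod_cast hij
      simp only
      gcongr
    have h := eVariationOn.sum_le (f := f) (s := Set.Ici 0) (n := N) hm
      fun i => Set.mem_Ici.mpr (by positivity)
    have h2 := ENNReal.toReal_mono hf h
    rw [ENNReal.toReal_sum fun _ _ => edist_ne_top _ _] at h2
    rw [pow_zero, mul_one]
    refine le_trans (le_of_eq (Finset.sum_congr rfl fun k _ => ?_)) h2
    rw [← dist_edist, Real.dist_eq, zero_add, Function.iterate_one, fwdDiff]
    push_cast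
    ring_nf
  | succ S ih =>
    obtain ⟨g, hg, hfg⟩ := hf
    obtain ⟨V, hV, h⟩ := ih hg
    have hgi := hg.halfLineIntegrable
    refine ⟨V, hV, fun δ hδ N x hx => ?_⟩
    have h1 : ∀ y, 0 ≤ y → fwdDiff δ f y = ∫ u in (0 : ℝ)..δ, g (y + u) := fun y hy => by
      rw [fwdDiff, hfg y hy, hfg _ (add_nonneg hy hδ), intervalIntegral.integral_comp_add_left,
        add_zero, add_sub_add_left_eq_sub, intervalIntegral.integral_interval_sub_left
        (hgi _ _ le_rfl (add_nonneg hy hδ)) (hgi _ _ le_rfl hy)]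
    have hi : ∀ k : ℕ, IntervalIntegrable
        (fun u => |(fwdDiff δ)^[S + 1] g (x + k * δ + u)|) volume 0 δ := fun k => by
      have hz : 0 ≤ x + k * δ := by positivity
      have := ((hgi.fwdDiff_iterate hδ (S + 1)).comp_add hz 0 δ le_rfl hδ).abs
      simpa only [add_comm (x + k * δ)] using this
    calc ∑ k ∈ range N, |(fwdDiff δ)^[S + 1 + 1] f (x + k * δ)|
        ≤ ∑ k ∈ range N, ∫ u in (0 : ℝ)..δ, |(fwdDiff δ)^[S + 1] g (x + k * δ + u)| := by
          refine Finset.sum_le_sum fun k _ => ?_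
          rw [Function.iterate_succ_apply, fwdDiff_iterate_integral hδ (S + 1) hgi h1
            (by positivity : 0 ≤ x + k * δ)]
          exact intervalIntegral.abs_integral_le_integral_abs hδ
      _ = ∫ u in (0 : ℝ)..δ, ∑ k ∈ range N, |(fwdDiff δ)^[S + 1] g (x + k * δ + u)| :=
          (intervalIntegral.integral_finsetSum fun k _ => hi k).symm
      _ ≤ ∫ _ in (0 : ℝ)..δ, V * δ ^ S := by
          refine intervalIntegral.integral_mono_on hδ
            (by simpa only [Finset.sum_fn] using IntervalIntegrable.sum (range N) fun k _ => hi k)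
            intervalIntegrable_const fun u hu => ?_
          simp only [add_right_comm x _ u]
          exact h δ hδ N (x + u) (add_nonneg hx hu.1)
      _ = V * δ ^ (S + 1) := by
          rw [intervalIntegral.integral_const, smul_eq_mul, sub_zero]
          ring

lemma fwdDiff_iterate_comp_mul (δ : ℝ) (j : ℕ) (f : ℝ → ℝ) (k : ℕ) :
    (fwdDiff 1)^[j] (fun ℓ : ℕ => f (ℓ * δ)) k = (fwdDiff δ)^[j] f (k * δ) := by
  induction j generalizing f with
  | zero => rfl
  | succ j ih =>
    rw [Function.iterate_succ_apply, Function.iterate_succ_apply, ← ih]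
    refine congrArg (fun g => (fwdDiff 1)^[j] g k) (funext fun ℓ => ?_)
    simp only [fwdDiff]
    push_cast
    ring_nf

lemma sum_mul_coeff_one_sub_X_mul (n : ℕ) {H : ℕ → ℝ} (hH : H (n + 1) = 0) (Q : PowerSeries ℝ) :
    ∑ ℓ ∈ range (n + 1), H ℓ * PowerSeries.coeff ℓ ((1 - PowerSeries.X) * Q) =
      -∑ ℓ ∈ range (n + 1), fwdDiff 1 H ℓ * PowerSeries.coeff ℓ Q := by
  have h1 : ∀ ℓ, H (ℓ + 1) * PowerSeries.coeff (ℓ + 1) ((1 - PowerSeries.X) * Q) =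
      H (ℓ + 1) * PowerSeries.coeff (ℓ + 1) Q - H (ℓ + 1) * PowerSeries.coeff ℓ Q := fun ℓ => by
    rw [sub_mul, one_mul, map_sub, PowerSeries.coeff_succ_X_mul, mul_sub]
  have h2 : ∀ ℓ, fwdDiff 1 H ℓ * PowerSeries.coeff ℓ Q =
      H (ℓ + 1) * PowerSeries.coeff ℓ Q - H ℓ * PowerSeries.coeff ℓ Q := fun ℓ => by
    rw [fwdDiff, sub_mul]
  simp only [h2, Finset.sum_sub_distrib]
  rw [Finset.sum_range_succ', Finset.sum_congr rfl fun ℓ _ => h1 ℓ, Finset.sum_sub_distrib,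
    Finset.sum_range_succ (fun ℓ => H (ℓ + 1) * PowerSeries.coeff ℓ Q), hH,
    Finset.sum_range_succ' (fun ℓ => H ℓ * PowerSeries.coeff ℓ Q)]
  simp [sub_mul]
  ring

lemma sum_mul_coeff_one_sub_X_pow_mul (n j : ℕ) {H : ℕ → ℝ} (hH : ∀ ℓ, n < ℓ → H ℓ = 0)
    (Q : PowerSeries ℝ) :
    ∑ ℓ ∈ range (n + 1), H ℓ * PowerSeries.coeff ℓ ((1 - PowerSeries.X) ^ j * Q) =
      (-1) ^ j * ∑ ℓ ∈ range (n + 1), (fwdDiff 1)^[j] H ℓ * PowerSeries.coeff ℓ Q := by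
  induction j generalizing H with
  | zero => simp
  | succ j ih =>
    rw [pow_succ', mul_assoc, sum_mul_coeff_one_sub_X_mul n (hH _ (Nat.lt_succ_self n)), ih]
    · rw [Function.iterate_succ_apply]
      ring
    · intro ℓ hℓ
      rw [fwdDiff, hH ℓ hℓ, hH _ (by omega), sub_zero]

lemma one_sub_X_pow_mul_geomSeries_pow (k : ℕ) (Q : PowerSeries ℝ) :
    (1 - PowerSeries.X) ^ k * (Q * geomSeries ^ k) = Q := by
  rw [mul_left_comm, ← mul_pow, mul_comm _ geomSeries, geomSeries_mul, one_pow, mul_one]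

lemma cesaroNum_mono (S : ℕ) : Monotone (cesaroNum S) := fun a b hab => by
  unfold cesaroNum
  exact_mod_cast Nat.choose_le_choose S (by omega)

lemma cesaroNum_le (S : ℕ) {n : ℕ} (hn : 1 ≤ n) : cesaroNum S n ≤ (S + 1) ^ S * n ^ S := by
  unfold cesaroNum
  rw [← mul_pow]
  have h : (S + n).choose S ≤ ((S + 1) * n) ^ S :=
    (Nat.choose_le_pow _ _).trans (Nat.pow_le_pow_left (by nlinarith) S)
  exact_mod_cast h

section Bound

variable {q : ℕ} {μ : Measure (Sph q)} [IsProbabilityMeasure μ] {d : ℕ → ℕ}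
  {Y : (ℓ : ℕ) → Fin (d ℓ) → Sph q → ℝ}

lemma Phi_eq_sum_cesaroKer (hq : 1 ≤ q) (hY : GoodBasis q μ d Y) (hrot : RotInvariant q μ)
    (S : ℕ) {h : ℝ → ℝ} (h1 : ∀ x, 1 < x → h x = 0) {n : ℕ} (hn : 1 ≤ n) (x ξ : Sph q) :
    Phi d Y h n x ξ = (-1) ^ (S + 1) * ∑ k ∈ range (n + 1),
      (fwdDiff (n : ℝ)⁻¹)^[S + 1] h (k * (n : ℝ)⁻¹) * cesaroKer S k x ξ := by
  have hn' : (0 : ℝ) < n := by exact_mod_cast hn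
  simp only [cesaroKer_eq_coeff, ← fwdDiff_iterate_comp_mul]
  rw [← sum_mul_coeff_one_sub_X_pow_mul, one_sub_X_pow_mul_geomSeries_pow]
  · simp only [Phi, sum_basis_mul_basis hq hY hrot, PowerSeries.coeff_mk, div_eq_mul_inv]
  · intro ℓ hℓ
    refine h1 _ ?_
    rw [← div_eq_mul_inv, one_lt_div hn']
    exact_mod_cast hℓ

lemma Phi_comm (h : ℝ → ℝ) (n : ℕ) (x ξ : Sph q) : Phi d Y h n x ξ = Phi d Y h n ξ x := by
  simp only [Phi, mul_comm (Y _ _ x)]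

lemma exists_integral_abs_Phi_le (hq : 1 ≤ q) {S : ℕ} (hS : q ≤ S) (hY : GoodBasis q μ d Y)
    (hrot : RotInvariant q μ) {h : ℝ → ℝ} (hh : GoodH S h) :
    ∃ B, 0 ≤ B ∧ ∀ n, 1 ≤ n → ∀ x, ∫ ζ, |Phi d Y h n x ζ| ∂μ ≤ B := by
  obtain ⟨V, hV, hvar⟩ := hh.2.2.2.sum_abs_fwdDiff_le
  refine ⟨V * (S + 1) ^ S, by positivity, fun n hn x => ?_⟩
  have hn' : (0 : ℝ) < n := by exact_mod_cast hn
  set D : ℕ → ℝ := fun k => (fwdDiff (n : ℝ)⁻¹)^[S + 1] h (k * (n : ℝ)⁻¹) with hD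
  have hv : ∑ k ∈ range (n + 1), |D k| ≤ V * (n : ℝ)⁻¹ ^ S := by
    simpa only [zero_add] using hvar (n : ℝ)⁻¹ (by positivity) (n + 1) 0 le_rfl
  have hP : ∀ ζ, |Phi d Y h n x ζ| ≤ ∑ k ∈ range (n + 1), |D k| * cesaroKer S k ζ x := fun ζ => by
    rw [Phi_comm, Phi_eq_sum_cesaroKer hq hY hrot S hh.2.1 hn, abs_mul, abs_pow, abs_neg, abs_one,
      one_pow, one_mul]
    refine (Finset.abs_sum_le_sum_abs _ _).trans (Finset.sum_le_sum fun k _ => ?_)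
    rw [abs_mul, abs_of_nonneg (cesaroKer_nonneg hq hS k ζ x)]
  have hi : ∀ k, Integrable (fun ζ => |D k| * cesaroKer S k ζ x) μ := fun k =>
    (integrable_of_continuous μ (cesaroKer_continuous S k x)).const_mul _
  calc ∫ ζ, |Phi d Y h n x ζ| ∂μ
      ≤ ∫ ζ, ∑ k ∈ range (n + 1), |D k| * cesaroKer S k ζ x ∂μ :=
        integral_mono_of_nonneg (ae_of_all _ fun _ => abs_nonneg _)
          (integrable_finsetSum _ fun k _ => hi k) (ae_of_all _ hP)
    _ = ∑ k ∈ range (n + 1), |D k| * cesaroNum S k := by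
        rw [integral_finsetSum _ fun k _ => hi k]
        simp only [integral_const_mul, integral_cesaroKer hY]
    _ ≤ ∑ k ∈ range (n + 1), |D k| * cesaroNum S n :=
        Finset.sum_le_sum fun k hk => mul_le_mul_of_nonneg_left
          (cesaroNum_mono S (Nat.lt_succ_iff.mp (mem_range.mp hk))) (abs_nonneg _)
    _ ≤ (V * (n : ℝ)⁻¹ ^ S) * ((S + 1) ^ S * n ^ S) := by
        rw [← Finset.sum_mul]
        exact mul_le_mul hv (cesaroNum_le S hn) (cesaroNum_pos S n).le (by positivity)
    _ = V * (S + 1) ^ S := by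
        rw [inv_pow]
        field_simp

end Bound

lemma InPi.mono {q n n' : ℕ} {f : Sph q → ℝ} (hf : InPi q n f) (h : n ≤ n') : InPi q n' f := by
  obtain ⟨P, hP, hf⟩ := hf
  exact ⟨P, hP.trans h, hf⟩

lemma InPi.const_mul {q n : ℕ} {f : Sph q → ℝ} (hf : InPi q n f) (a : ℝ) :
    InPi q n fun x => a * f x := by
  obtain ⟨P, hP, hf⟩ := hf
  refine ⟨a • P, (MvPolynomial.totalDegree_smul_le a P).trans hP, fun x => ?_⟩
  simp only [hf, MvPolynomial.smul_eval]

lemma InPi.sum {q n : ℕ} {ι : Type*} (s : Finset ι) {f : ι → Sph q → ℝ}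
    (hf : ∀ i ∈ s, InPi q n (f i)) : InPi q n fun x => ∑ i ∈ s, f i x := by
  choose! P hP h using hf
  refine ⟨∑ i ∈ s, P i, MvPolynomial.totalDegree_finsetSum_le hP, fun x => ?_⟩
  rw [map_sum]
  exact Finset.sum_congr rfl fun i hi => h i hi x

lemma InPi.mul {q n n' : ℕ} {f g : Sph q → ℝ} (hf : InPi q n f) (hg : InPi q n' g) :
    InPi q (n + n') fun x => f x * g x := by
  obtain ⟨P, hP, hf⟩ := hf
  obtain ⟨Q, hQ, hg⟩ := hg
  refine ⟨P * Q, (MvPolynomial.totalDegree_mul P Q).trans (add_le_add hP hQ), fun x => ?_⟩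
  simp only [hf, hg, map_mul]

lemma abs_le_supNorm {q : ℕ} {f : Sph q → ℝ} (hf : Continuous f) (x : Sph q) :
    |f x| ≤ supNorm f := by
  obtain ⟨M, hM⟩ := isCompact_univ.exists_bound_of_continuousOn hf.continuousOn
  exact le_ciSup (f := fun x => |f x|) ⟨M, by rintro _ ⟨y, rfl⟩; exact hM y trivial⟩ x

lemma supNormOn_univ {q : ℕ} (f : Sph q → ℝ) : supNormOn Set.univ f = supNorm f := by
  simp [supNormOn, supNorm]

lemma supNorm_nonneg {q : ℕ} (f : Sph q → ℝ) : 0 ≤ supNorm f :=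
  Real.iSup_nonneg fun _ => abs_nonneg _

section Operators

variable {q : ℕ} {μ : Measure (Sph q)} {d : ℕ → ℕ}
  {Y : (ℓ : ℕ) → Fin (d ℓ) → Sph q → ℝ} {h : ℝ → ℝ}

lemma InHarm.inPi (hY : GoodBasis q μ d Y) {N : ℕ} {f : Sph q → ℝ}
    (hf : InHarm d Y N f) : InPi q N f := by
  obtain ⟨b, hb⟩ := hf
  rw [funext hb]
  refine InPi.sum _ fun ℓ hℓ => InPi.sum _ fun k _ => ((hY.1 ℓ k).inPi.mono ?_).const_mul _
  exact Nat.lt_succ_iff.mp (mem_range.mp hℓ)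

lemma Phi_inHarm (n : ℕ) (x : Sph q) : InHarm d Y n (Phi d Y h n x) :=
  ⟨fun ℓ k => h (ℓ / n) * Y ℓ k x, fun ξ => by simp only [Phi, Finset.mul_sum, mul_assoc]⟩

lemma Phi_continuous (hY : GoodBasis q μ d Y) (n : ℕ) (x : Sph q) :
    Continuous (Phi d Y h n x) := ((Phi_inHarm n x).inPi hY).continuous

lemma MZQuad.sigmaOp_eq_sigmaStar (hY : GoodBasis q μ d Y) {m : ℕ} {C : Finset (Sph q)}
    {w : Sph q → ℝ} {c₀ : ℝ} (hC : MZQuad q μ m C w c₀) {N n : ℕ} (hNn : N + n ≤ 2 * m)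
    {P : Sph q → ℝ} (hP : InHarm d Y N P) (x : Sph q) :
    sigmaOp d Y h n C w P x = sigmaStar μ d Y h n P x := by
  simp only [sigmaOp, mul_assoc]
  exact hC.1 (fun ξ => P ξ * Phi d Y h n x ξ)
    (((hP.inPi hY).mul ((Phi_inHarm n x).inPi hY)).mono hNn)

lemma MZQuad.sum_abs_le {m : ℕ} {C : Finset (Sph q)}
    {w : Sph q → ℝ} {c₀ : ℝ} (hC : MZQuad q μ m C w c₀) {P : Sph q → ℝ} (hP : InPi q (2 * m) P) :
    ∑ ξ ∈ C, |w ξ| * |P ξ| ≤ c₀ * ∫ x, |P x| ∂μ := by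
  simpa using hC.2 P hP 1 le_rfl

variable [IsProbabilityMeasure μ]

lemma sigmaStar_eq_sum (hY : GoodBasis q μ d Y) (n : ℕ) {f : Sph q → ℝ} (hf : Continuous f)
    (x : Sph q) : sigmaStar μ d Y h n f x =
      ∑ ℓ ∈ range (n + 1), ∑ k, (h (ℓ / n) * ∫ ζ, Y ℓ k ζ * f ζ ∂μ) * Y ℓ k x := by
  have h1 : ∀ ζ, f ζ * Phi d Y h n x ζ =
      ∑ ℓ ∈ range (n + 1), ∑ k, (h (ℓ / n) * Y ℓ k x) * (Y ℓ k ζ * f ζ) := fun ζ => by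
    simp only [Phi, Finset.mul_sum]
    exact Finset.sum_congr rfl fun ℓ _ => Finset.sum_congr rfl fun k _ => by ring
  have hi : ∀ (ℓ : ℕ) k, Integrable
      (fun ζ => (h (ℓ / n) * Y ℓ k x) * (Y ℓ k ζ * f ζ)) μ := fun ℓ k =>
    (integrable_of_continuous μ ((hY.continuous ℓ k).fun_mul hf)).const_mul _
  simp only [sigmaStar, h1]
  rw [integral_finsetSum _ fun ℓ _ => integrable_finsetSum _ fun k _ => hi ℓ k]
  refine Finset.sum_congr rfl fun ℓ _ => ?_
  rw [integral_finsetSum _ fun k _ => hi ℓ k]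
  refine Finset.sum_congr rfl fun k _ => ?_
  rw [integral_const_mul]
  ring

lemma sigmaStar_inHarm (hY : GoodBasis q μ d Y) (n : ℕ) {f : Sph q → ℝ} (hf : Continuous f) :
    InHarm d Y n (sigmaStar μ d Y h n f) :=
  ⟨_, sigmaStar_eq_sum hY n hf⟩

lemma integral_basis_mul_sum (hY : GoodBasis q μ d Y) (N : ℕ) (b : (ℓ : ℕ) → Fin (d ℓ) → ℝ)
    (ℓ : ℕ) (k : Fin (d ℓ)) :
    ∫ x, Y ℓ k x * ∑ j ∈ range (N + 1), ∑ i, b j i * Y j i x ∂μ =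
      if ℓ ≤ N then b ℓ k else 0 := by
  simp only [Finset.mul_sum, mul_left_comm (Y ℓ k _)]
  have hi : ∀ j i, Integrable (fun x => b j i * (Y ℓ k x * Y j i x)) μ := fun j i =>
    (integrable_of_continuous μ ((hY.continuous ℓ k).fun_mul (hY.continuous j i))).const_mul _
  rw [integral_finsetSum _ fun j _ => integrable_finsetSum _ fun i _ => hi j i]
  have h1 : ∀ j, ∫ x, ∑ i, b j i * (Y ℓ k x * Y j i x) ∂μ = if ℓ = j then b ℓ k else 0 := by
    intro j
    rw [integral_finsetSum _ fun i _ => hi j i]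
    simp only [integral_const_mul, hY.2.1]
    split_ifs with hj
    · subst hj
      simp [Fin.val_inj]
    · simp [hj]
  simp only [h1, Finset.sum_ite_eq, mem_range, Nat.lt_succ_iff]

lemma sigmaStar_eq_self (hY : GoodBasis q μ d Y) (h1 : ∀ x, 0 ≤ x → x ≤ 1 / 2 → h x = 1)
    {N n : ℕ} (hn : 2 * N ≤ n) {Q : Sph q → ℝ} (hQ : InHarm d Y N Q) (x : Sph q) :
    sigmaStar μ d Y h n Q x = Q x := by
  rw [sigmaStar_eq_sum hY n (hQ.inPi hY).continuous]
  obtain ⟨b, hb⟩ := hQ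
  simp only [hb, integral_basis_mul_sum hY]
  rw [← Finset.sum_subset (Finset.range_mono (show N + 1 ≤ n + 1 by omega))]
  · refine Finset.sum_congr rfl fun ℓ hℓ => Finset.sum_congr rfl fun k _ => ?_
    have hℓ' : ℓ ≤ N := Nat.lt_succ_iff.mp (mem_range.mp hℓ)
    rw [if_pos hℓ', h1 _ (by positivity), one_mul]
    refine div_le_of_le_mul₀ (by positivity) (by norm_num) ?_
    have : (2 * ℓ : ℝ) ≤ n := by exact_mod_cast (by omega : 2 * ℓ ≤ n)
    linarith
  · intro ℓ _ hℓ
    rw [mem_range, Nat.lt_succ_iff] at hℓ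
    simp [hℓ]

lemma abs_sigmaStar_le (hY : GoodBasis q μ d Y) {n : ℕ} {x : Sph q} {B M : ℝ}
    (hB : ∫ ζ, |Phi d Y h n x ζ| ∂μ ≤ B) {g : Sph q → ℝ} (hg : ∀ ζ, |g ζ| ≤ M) :
    |sigmaStar μ d Y h n g x| ≤ M * B := by
  have hM : 0 ≤ M := (abs_nonneg _).trans (hg x)
  refine abs_integral_le_integral_abs.trans ((integral_mono_of_nonneg
    (ae_of_all _ fun _ => abs_nonneg _) ((integrable_of_continuous μ
    (Phi_continuous (h := h) hY n x).abs).const_mul M) (ae_of_all _ fun ζ => ?_)).trans ?_)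
  · simp only [abs_mul]
    exact mul_le_mul_of_nonneg_right (hg ζ) (abs_nonneg _)
  · rw [integral_const_mul]
    exact mul_le_mul_of_nonneg_left hB hM

lemma sigmaStar_sub (hY : GoodBasis q μ d Y) (n : ℕ) {f g : Sph q → ℝ} (hf : Continuous f)
    (hg : Continuous g) (x : Sph q) : sigmaStar μ d Y h n (fun ζ => f ζ - g ζ) x =
      sigmaStar μ d Y h n f x - sigmaStar μ d Y h n g x := by
  have hP := Phi_continuous (h := h) hY n x
  simp only [sigmaStar, sub_mul]
  exact integral_sub (integrable_of_continuous μ (hf.fun_mul hP))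
    (integrable_of_continuous μ (hg.fun_mul hP))

lemma tendsto_sigmaStar (hq : 1 ≤ q) (hY : GoodBasis q μ d Y) (hrot : RotInvariant q μ)
    (h1 : ∀ x, 0 ≤ x → x ≤ 1 / 2 → h x = 1) {B : ℝ} (hB0 : 0 ≤ B)
    (hB : ∀ n, 1 ≤ n → ∀ x, ∫ ζ, |Phi d Y h n x ζ| ∂μ ≤ B) {f : Sph q → ℝ} (hf : Continuous f)
    (x : Sph q) :
    Filter.Tendsto (fun n => sigmaStar μ d Y h n f x) Filter.atTop (nhds (f x)) := by
  refine Metric.tendsto_atTop.mpr fun ε hε => ?_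
  obtain ⟨N, Q, hQ, hQf⟩ := exists_inHarm_approx hq hY hrot hf
    (show 0 < ε / (B + 2) by positivity)
  refine ⟨2 * N + 1, fun n hn => ?_⟩
  have hQc := (hQ.inPi hY).continuous
  have h2 := abs_sigmaStar_le (g := fun ζ => Q ζ - f ζ) hY (hB n (by omega) x) hQf
  rw [sigmaStar_sub hY n hQc hf, sigmaStar_eq_self hY h1 (by omega) hQ] at h2
  have h3 := hQf x
  have h4 : ε / (B + 2) * B + ε / (B + 2) < ε := by
    rw [div_mul_eq_mul_div, ← add_div, div_lt_iff₀ (by positivity)]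
    nlinarith
  rw [Real.dist_eq]
  have h5 := abs_sub_le (sigmaStar μ d Y h n f x) (Q x) (f x)
  rw [abs_sub_comm _ (Q x)] at h5
  linarith

lemma WrNorm_bounds (hY : GoodBasis q μ d Y) {r : ℝ} {f : Sph q → ℝ}
    (hf : MemWrOn Set.univ μ d Y h r f) (hf1 : WrNorm μ d Y h r f = 1) (x : Sph q) :
    |f x| ≤ 1 ∧ ∀ n : ℕ, |sigmaStar μ d Y h (2 ^ (n + 1)) f x - sigmaStar μ d Y h (2 ^ n) f x| ≤
      (2 ^ (-r)) ^ (n + 1) := by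
  have h0 : ∀ n, 0 ≤ WrSeqOn Set.univ μ d Y h r f n := fun n => by
    rw [WrSeqOn, supNormOn_univ]
    exact mul_nonneg (by positivity) (supNorm_nonneg _)
  have h1 : supNorm f + ⨆ n, WrSeqOn Set.univ μ d Y h r f n = 1 := hf1
  refine ⟨?_, fun n => ?_⟩
  · have := abs_le_supNorm hf.1 x
    have := Real.iSup_nonneg h0
    linarith
  · have h2 := le_ciSup hf.2 n
    have h3 : WrSeqOn Set.univ μ d Y h r f n ≤ 1 := by linarith [supNorm_nonneg f]
    rw [WrSeqOn, supNormOn_univ] at h3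
    have hc : ∀ n, Continuous (sigmaStar μ d Y h n f) := fun n =>
      ((sigmaStar_inHarm hY n hf.1).inPi hY).continuous
    refine (abs_le_supNorm ((hc (2 ^ (n + 1))).fun_sub (hc (2 ^ n))) x).trans ?_
    have h4 : ((2 : ℝ) ^ (-r)) ^ (n + 1) = ((2 : ℝ) ^ (((n : ℝ) + 1) * r))⁻¹ := by
      rw [← Real.rpow_natCast, ← Real.rpow_mul zero_le_two, ← Real.rpow_neg zero_le_two]
      push_cast
      ring_nf
    rw [h4, ← one_div, le_div_iff₀' (by positivity)]
    exact h3

lemma abs_sigmaStar_two_pow_sub_le (hq : 1 ≤ q) (hY : GoodBasis q μ d Y) (hrot : RotInvariant q μ)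
    (h1 : ∀ x, 0 ≤ x → x ≤ 1 / 2 → h x = 1) {B : ℝ} (hB0 : 0 ≤ B)
    (hB : ∀ n, 1 ≤ n → ∀ x, ∫ ζ, |Phi d Y h n x ζ| ∂μ ≤ B) {r : ℝ} (hr : 0 < r) {f : Sph q → ℝ}
    (hf : MemWrOn Set.univ μ d Y h r f) (hf1 : WrNorm μ d Y h r f = 1) (k : ℕ) (x : Sph q) :
    |sigmaStar μ d Y h (2 ^ k) f x - f x| ≤ (2 ^ (-r)) ^ k / (1 - 2 ^ (-r)) := by
  have hρ0 : (0 : ℝ) < 2 ^ (-r) := by positivity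
  have hρ : (2 : ℝ) ^ (-r) < 1 := Real.rpow_lt_one_of_one_lt_of_neg one_lt_two (by linarith)
  have h2 := dist_le_of_le_geometric_of_tendsto (2 ^ (-r)) 1 hρ
    (f := fun k => sigmaStar μ d Y h (2 ^ k) f x) (fun n => ?_)
    ((tendsto_sigmaStar hq hY hrot h1 hB0 hB hf.1 x).comp
      (tendsto_pow_atTop_atTop_of_one_lt one_lt_two)) k
  · rwa [one_mul, Real.dist_eq] at h2
  · rw [dist_comm, Real.dist_eq, one_mul]
    exact ((WrNorm_bounds hY hf hf1 x).2 n).trans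
      (pow_le_pow_of_le_one hρ0.le hρ.le (Nat.le_succ n))

lemma MZQuad.abs_sub_sigmaOp_le (hY : GoodBasis q μ d Y)
    (h1 : ∀ x, 0 ≤ x → x ≤ 1 / 2 → h x = 1) {m : ℕ} {C : Finset (Sph q)} {w : Sph q → ℝ}
    {c₀ B E : ℝ} (hc₀ : 0 ≤ c₀) (hC : MZQuad q μ m C w c₀) {N n : ℕ} (hNn : 2 * N ≤ n)
    (hnm : n ≤ m) {x : Sph q} (hB : ∫ ζ, |Phi d Y h n x ζ| ∂μ ≤ B) {P f : Sph q → ℝ}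
    (hP : InHarm d Y N P) (hPf : ∀ y, |P y - f y| ≤ E) :
    |f x - sigmaOp d Y h n C w f x| ≤ E * (1 + c₀ * B) := by
  have hE : 0 ≤ E := (abs_nonneg _).trans (hPf x)
  have h2 : sigmaOp d Y h n C w P x = P x := by
    rw [hC.sigmaOp_eq_sigmaStar hY (by omega) hP, sigmaStar_eq_self hY h1 hNn hP]
  have h3 : |P x - sigmaOp d Y h n C w f x| ≤ E * (c₀ * B) := by
    rw [← h2, sigmaOp, sigmaOp, ← Finset.sum_sub_distrib]
    calc |∑ ξ ∈ C, (w ξ * P ξ * Phi d Y h n x ξ - w ξ * f ξ * Phi d Y h n x ξ)|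
        ≤ ∑ ξ ∈ C, E * (|w ξ| * |Phi d Y h n x ξ|) := by
          refine (Finset.abs_sum_le_sum_abs _ _).trans (Finset.sum_le_sum fun ξ _ => ?_)
          rw [← sub_mul, ← mul_sub, abs_mul, abs_mul, mul_right_comm, mul_comm]
          exact mul_le_mul_of_nonneg_right (hPf ξ) (by positivity)
      _ ≤ E * (c₀ * B) := by
          rw [← Finset.mul_sum]
          refine mul_le_mul_of_nonneg_left ((hC.sum_abs_le
            (((Phi_inHarm n x).inPi hY).mono (by omega))).trans ?_) hE
          exact mul_le_mul_of_nonneg_left hB hc₀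
  have h4 := abs_sub_le (f x) (P x) (sigmaOp d Y h n C w f x)
  have h5 := hPf x
  rw [abs_sub_comm] at h5
  linarith

end Operators

lemma exists_two_pow_le {n : ℕ} (hn : 2 ≤ n) : ∃ k, 2 * 2 ^ k ≤ n ∧ n ≤ 4 * 2 ^ k := by
  obtain ⟨k, hk⟩ : ∃ k, Nat.log 2 n = k + 1 :=
    ⟨Nat.log 2 n - 1, by have := Nat.log_pos one_lt_two hn; omega⟩
  have h1 := Nat.pow_log_le_self 2 (show n ≠ 0 by omega)
  have h2 := Nat.lt_pow_succ_log_self one_lt_two n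
  rw [hk] at h1 h2
  refine ⟨k, ?_, ?_⟩
  · rwa [pow_succ'] at h1
  · rw [pow_succ, pow_succ] at h2
    omega

lemma two_rpow_neg_pow_le {r : ℝ} (hr : 0 < r) {n k : ℕ} (hn : 1 ≤ n) (h : n ≤ 4 * 2 ^ k) :
    ((2 : ℝ) ^ (-r)) ^ k ≤ 4 ^ r * (n : ℝ) ^ (-r) := by
  have hn' : (0 : ℝ) < n := by exact_mod_cast hn
  have h1 : (n : ℝ) ≤ 4 * 2 ^ k := by exact_mod_cast h
  have h2 : ((2 : ℝ) ^ (-r)) ^ k = ((2 : ℝ) ^ k) ^ (-r) := by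
    rw [← Real.rpow_natCast, ← Real.rpow_natCast, ← Real.rpow_mul zero_le_two,
      ← Real.rpow_mul zero_le_two, mul_comm]
  have h3 := Real.rpow_le_rpow_of_nonpos hn' h1 (show -r ≤ 0 by linarith)
  rw [Real.mul_rpow (by norm_num) (by positivity), ← h2, Real.rpow_neg (by norm_num) r] at h3
  rwa [← inv_mul_le_iff₀ (by positivity)]

/-- Global approximation: if `f ∈ W_r` with `‖f‖_{W_r} = 1` then
`‖f − σ_n(C,W;h;f)‖_∞ ≤ c n^{-r}` for `1 ≤ n ≤ m`. -/
theorem statement6 (q S : ℕ) (hq : 1 ≤ q) (hSq : q ≤ S) (h : ℝ → ℝ) (hh : GoodH S h)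
    (μ : Measure (Sph q)) (hμ : IsProbabilityMeasure μ) (hrot : RotInvariant q μ)
    (d : ℕ → ℕ) (Y : (ℓ : ℕ) → Fin (d ℓ) → Sph q → ℝ) (hY : GoodBasis q μ d Y)
    (r : ℝ) (hr : 0 < r) (c₀ : ℝ) (hc₀ : 0 < c₀) :
    ∃ c : ℝ, 0 < c ∧ ∀ m : ℕ, 1 ≤ m → ∀ (C : Finset (Sph q)) (w : Sph q → ℝ),
      MZQuad q μ m C w c₀ → ∀ f : Sph q → ℝ,
        MemWrOn Set.univ μ d Y h r f → WrNorm μ d Y h r f = 1 →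
        ∀ n : ℕ, 1 ≤ n → n ≤ m →
          supNorm (fun x => f x - sigmaOp d Y h n C w f x) ≤ c * (n : ℝ) ^ (-r) := by
  obtain ⟨B, hB0, hB⟩ := exists_integral_abs_Phi_le hq hSq hY hrot hh
  have hρ : (2 : ℝ) ^ (-r) < 1 := Real.rpow_lt_one_of_one_lt_of_neg one_lt_two (by linarith)
  have hρ' : 0 < 1 - (2 : ℝ) ^ (-r) := by linarith
  refine ⟨(1 + 4 ^ r / (1 - 2 ^ (-r))) * (1 + c₀ * B), by positivity,
    fun m _ C w hC f hf hf1 n hn hnm => ?_⟩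
  have : Nonempty (Sph q) := ⟨⟨EuclideanSpace.single 0 1, by simp⟩⟩
  have hn' : (0 : ℝ) < n := by exact_mod_cast hn
  refine ciSup_le fun x => ?_
  rcases hn.eq_or_lt with rfl | hn2
  · have h1 := hC.abs_sub_sigmaOp_le hY hh.1 hc₀.le (N := 0) (by omega) hnm (hB 1 le_rfl x)
      (P := fun _ => 0) (f := f) (E := 1) ⟨fun _ _ => 0, by simp⟩
      fun y => by simpa using (WrNorm_bounds hY hf hf1 y).1
    rw [Nat.cast_one, Real.one_rpow, mul_one]
    refine h1.trans (mul_le_mul_of_nonneg_right ?_ (by positivity))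
    exact le_add_of_nonneg_right (by positivity)
  · obtain ⟨k, hk1, hk2⟩ := exists_two_pow_le hn2
    refine (hC.abs_sub_sigmaOp_le hY hh.1 hc₀.le hk1 hnm (hB n hn x)
      (sigmaStar_inHarm hY (2 ^ k) hf.1)
      (abs_sigmaStar_two_pow_sub_le hq hY hrot hh.1 hB0 hB hr hf hf1 k)).trans ?_
    rw [mul_right_comm]
    refine mul_le_mul_of_nonneg_right ?_ (by positivity)
    rw [add_mul, div_mul_eq_mul_div]
    exact le_add_of_nonneg_of_le (by positivity)
      (div_le_div_of_nonneg_right (two_rpow_neg_pow_le hr hn hk2) hρ'.le)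

end SD
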